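/- arXiv:1711.00203 — 2 statements merged into one kernel-verified Lean document; each statement's English description precedes it below -/
import Mathlib

section
/- Let 1<p<∞ and let w∈A_p on ℝⁿ. Set σ=w^{1−p′} (the dual weight, p′=p/(p−1)) and ε=(p−1)/(1+2^{n+1}[σ]_{A_∞}). Then w∈A_{p−ε} and [w]_{A_{p−ε}} ≤ 2^{p−1}[w]_{A_p}. -/
open MeasureTheory Set Filter
open scoped ENNReal NNReal Topology

noncomputable section

namespace SparseCZ

/-- Euclidean space `ℝⁿ`. -/
abbrev Rn (n : ℕ) := EuclideanSpace ℝ (Fin n)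

/-- An axis-parallel (half-open) cube in `ℝⁿ`, recorded by its lower corner and sidelength. -/
structure Cube (n : ℕ) where
  corner : Fin n → ℝ
  side : ℝ
  side_pos : 0 < side

namespace Cube

variable {n : ℕ}

/-- The set of points of a cube. -/
def toSet (Q : Cube n) : Set (Rn n) :=
  {x | ∀ i, Q.corner i ≤ x i ∧ x i < Q.corner i + Q.side}

/-- `2^m Q`: the cube concentric with `Q` of sidelength `2^m · ℓ_Q`. -/
def dilatePow (Q : Cube n) (m : ℕ) : Cube n where
  corner := fun i => Q.corner i + Q.side / 2 - 2 ^ m * Q.side / 2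
  side := 2 ^ m * Q.side
  side_pos := by have := Q.side_pos; positivity

end Cube

variable {n : ℕ}

/-- A dyadic grid in `ℝⁿ`: cubes of sidelengths `2^k`, pairwise intersections are one of the two
cubes or empty, and the cubes of each fixed sidelength partition `ℝⁿ`. -/
def IsDyadicGrid (D : Set (Cube n)) : Prop :=
  (∀ Q ∈ D, ∃ k : ℤ, Q.side = 2 ^ k) ∧
  (∀ Q ∈ D, ∀ R ∈ D,
    Q.toSet ∩ R.toSet = Q.toSet ∨ Q.toSet ∩ R.toSet = R.toSet ∨ Q.toSet ∩ R.toSet = ∅) ∧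
  (∀ k : ℤ, ∀ x : Rn n, ∃! Q : Cube n, Q ∈ D ∧ Q.side = 2 ^ k ∧ x ∈ Q.toSet)

/-- A sparse family of cubes. -/
def IsSparse (S : Set (Cube n)) : Prop :=
  ∀ Q ∈ S, volume (⋃ P ∈ {P | P ∈ S ∧ P.toSet ⊂ Q.toSet}, Cube.toSet P) ≤ volume Q.toSet / 2

/-- Average `|s|⁻¹ ∫_s f` of an `ℝ≥0∞`-valued function. -/
def avgE (s : Set (Rn n)) (f : Rn n → ℝ≥0∞) : ℝ≥0∞ :=
  (volume s)⁻¹ * ∫⁻ x in s, f x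

/-- The Hardy–Littlewood maximal operator over (axis-parallel) cubes. -/
def hlMax (f : Rn n → ℝ≥0∞) (x : Rn n) : ℝ≥0∞ :=
  ⨆ (Q : Cube n) (_ : x ∈ Q.toSet), avgE Q.toSet f

/-- Sparse operator `A_{D,S} f = Σ_{Q∈S} f_Q χ_Q`. -/
def sparseOp (S : Set (Cube n)) (f : Rn n → ℝ≥0∞) (x : Rn n) : ℝ≥0∞ :=
  ∑' Q : S, Set.indicator (Q.1.toSet) (fun _ => avgE Q.1.toSet f) x

/-- Shifted sparse operator `T_{S,m} f = Σ_{Q∈S} f_{2^m Q} χ_Q`. -/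
def sparseOpShift (S : Set (Cube n)) (m : ℕ) (f : Rn n → ℝ≥0∞) (x : Rn n) : ℝ≥0∞ :=
  ∑' Q : S, Set.indicator (Q.1.toSet) (fun _ => avgE (Q.1.dilatePow m).toSet f) x

/-- The median `m_Q(g)` of a function over a cube. -/
def median (g : Rn n → ℝ) (Q : Cube n) : ℝ :=
  sSup {l : ℝ | volume {x ∈ Q.toSet | l < g x} ≤ volume Q.toSet / 2 ∧
                volume {x ∈ Q.toSet | g x < l} ≤ volume Q.toSet / 2}

/-- A weight: a positive, measurable, locally integrable function. -/
def IsWeight (w : Rn n → ℝ) : Prop :=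
  Measurable w ∧ (∀ x, 0 < w x) ∧ LocallyIntegrable w volume

/-- `w(s) = ∫_s w`. -/
def wInt (w : Rn n → ℝ) (s : Set (Rn n)) : ℝ≥0∞ :=
  ∫⁻ x in s, ENNReal.ofReal (w x)

/-- The measure `w·dx`. -/
def wMeasure (w : Rn n → ℝ) : Measure (Rn n) :=
  volume.withDensity fun x => ENNReal.ofReal (w x)

/-- The Muckenhoupt `A_p` characteristic `[w]_{A_p}`. -/
def ApConst (n : ℕ) (p : ℝ) (w : Rn n → ℝ) : ℝ≥0∞ :=
  ⨆ Q : Cube n,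
    avgE Q.toSet (fun x => ENNReal.ofReal (w x)) *
      (avgE Q.toSet fun x => ENNReal.ofReal (w x ^ (1 - p / (p - 1)))) ^ (p - 1)

/-- The Fujii–Wilson `A_∞` characteristic `[w]_{A_∞}`. -/
def AinftyConst (n : ℕ) (w : Rn n → ℝ) : ℝ≥0∞ :=
  ⨆ Q : Cube n,
    (wInt w Q.toSet)⁻¹ *
      ∫⁻ x in Q.toSet, hlMax (fun y => ENNReal.ofReal (Set.indicator Q.toSet w y)) x

/-- The weighted dyadic maximal operator `M^D_w`. -/
def dyadicMaxW (D : Set (Cube n)) (w : Rn n → ℝ) (f : Rn n → ℝ≥0∞) (x : Rn n) : ℝ≥0∞ :=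
  ⨆ (Q : Cube n) (_ : Q ∈ D) (_ : x ∈ Q.toSet),
    (wInt w Q.toSet)⁻¹ * ∫⁻ y in Q.toSet, f y * ENNReal.ofReal (w y)

/-- A Calderón–Zygmund operator `T` with standard kernel `K` (constant `c`, smoothness `δ`). -/
structure IsCZO (n : ℕ) (T : (Rn n → ℝ) → Rn n → ℝ)
    (K : Rn n → Rn n → ℝ) (c δ : ℝ) : Prop where
  c_pos : 0 < c
  delta_pos : 0 < δ
  delta_le_one : δ ≤ 1
  size : ∀ x y, x ≠ y → |K x y| ≤ c / dist x y ^ n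
  smooth : ∀ x x' y : Rn n, x ≠ y → dist x x' ≤ dist x y / 2 →
    |K x y - K x' y| + |K y x - K y x'| ≤ c * dist x x' ^ δ / dist x y ^ ((n : ℝ) + δ)
  linear : IsLinearMap ℝ T
  l2_bounded : ∃ A : ℝ≥0∞, A ≠ ⊤ ∧ ∀ f, eLpNorm (T f) 2 volume ≤ A * eLpNorm f 2 volume
  repr : ∀ f : Rn n → ℝ, Integrable f volume → ∀ x ∉ tsupport f, T f x = ∫ y, K x y * f y

/-- The maximal truncated operator `T**` associated with a kernel `K`. -/
def maxTrunc (K : Rn n → Rn n → ℝ) (f : Rn n → ℝ) (x : Rn n) : ℝ :=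
  ⨆ e : {e : ℝ × ℝ // 0 < e.1 ∧ e.1 < e.2},
    |∫ y in {y | e.1.1 < dist x y ∧ dist x y < e.1.2}, K x y * f y|

/-- The `L¹ → L^{1,∞}` operator (quasi-)norm `sup {λ·|{|Uf|>λ}| : λ>0, ‖f‖₁ ≤ 1}`. -/
def weakNorm11 (U : (Rn n → ℝ) → Rn n → ℝ) : ℝ≥0∞ :=
  ⨆ (f : Rn n → ℝ) (_ : eLpNorm f 1 volume ≤ 1) (l : {l : ℝ // 0 < l}),
    ENNReal.ofReal l.1 * volume {x | l.1 < |U f x|}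

/-- A Banach function space over `(ℝⁿ, dx)` (rearrangement invariance not required),
described by its function norm `ρ` acting on nonnegative (`ℝ≥0∞`-valued) functions. -/
structure BFS (n : ℕ) where
  ρ : (Rn n → ℝ≥0∞) → ℝ≥0∞
  zero_iff : ∀ f, ρ f = 0 ↔ f =ᵐ[volume] 0
  add_le : ∀ f g, ρ (fun x => f x + g x) ≤ ρ f + ρ g
  smul_eq : ∀ (a : ℝ≥0) (f), ρ (fun x => (a : ℝ≥0∞) * f x) = a * ρ f
  mono : ∀ f g, f ≤ᵐ[volume] g → ρ f ≤ ρ g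
  fatou : ∀ f : ℕ → Rn n → ℝ≥0∞, Monotone f → ρ (fun x => ⨆ k, f k x) = ⨆ k, ρ (f k)
  indicator_lt_top : ∀ E : Set (Rn n), MeasurableSet E → volume E < ⊤ → ρ (E.indicator 1) < ⊤
  setIntegral_le : ∀ E : Set (Rn n), MeasurableSet E → volume E < ⊤ →
    ∃ C : ℝ≥0∞, C ≠ ⊤ ∧ ∀ f, ∫⁻ x in E, f x ≤ C * ρ f

/-- The decreasing rearrangement of `f` with respect to the measure `μ`. -/
def rearr {α : Type*} [MeasurableSpace α] (μ : Measure α) (f : α → ℝ≥0∞) (t : ℝ) : ℝ≥0∞ :=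
  sInf {l : ℝ≥0∞ | μ {x | l < f x} ≤ ENNReal.ofReal t}

/-- Lebesgue measure on `(0,∞)`. -/
def lebPos : Measure ℝ := volume.restrict (Set.Ioi 0)

/-- A rearrangement invariant quasi-Banach function space, given (via the Luxemburg
representation) by its function quasi-norm `ρ` over `(ℝ⁺, dt)`; the (weighted) norm of a
function on `ℝⁿ` is `ρ` applied to its decreasing rearrangement. -/
structure RIQBFS where
  ρ : (ℝ → ℝ≥0∞) → ℝ≥0∞
  quasi_triangle : ∃ Cq : ℝ≥0∞, 1 ≤ Cq ∧ Cq ≠ ⊤ ∧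
    ∀ f g, ρ (fun t => f t + g t) ≤ Cq * (ρ f + ρ g)
  smul_eq : ∀ (a : ℝ≥0) (f), ρ (fun t => (a : ℝ≥0∞) * f t) = a * ρ f
  zero_iff : ∀ f, ρ f = 0 ↔ f =ᵐ[lebPos] 0
  mono : ∀ f g, f ≤ᵐ[lebPos] g → ρ f ≤ ρ g
  fatou : ∀ f : ℕ → ℝ → ℝ≥0∞, Monotone f → ρ (fun t => ⨆ k, f k t) = ⨆ k, ρ (f k)
  rearr_invariant : ∀ f g,
    (∀ l : ℝ≥0∞, lebPos {t | l < f t} = lebPos {t | l < g t}) → ρ f = ρ g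

namespace RIQBFS

/-- The norm of `X(w)`: `‖f‖_{X(w)} = ρ(f*_w)`. -/
def normW (X : RIQBFS) {n : ℕ} (w : Rn n → ℝ) (f : Rn n → ℝ≥0∞) : ℝ≥0∞ :=
  X.ρ (rearr (wMeasure w) f)

/-- The (unweighted) norm of `X`: `‖f‖_X = ρ(f*)`. -/
def normV (X : RIQBFS) {n : ℕ} (f : Rn n → ℝ≥0∞) : ℝ≥0∞ :=
  X.ρ (rearr (volume : Measure (Rn n)) f)

/-- `h_X(t)`: the operator norm of the dilation `D_t f(s) = f(s/t)` on `X̄`. -/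
def dilNorm (X : RIQBFS) (t : ℝ) : ℝ≥0∞ :=
  ⨆ (f : ℝ → ℝ≥0∞) (_ : X.ρ f ≤ 1), X.ρ fun s => f (s / t)

/-- The lower Boyd index `p_X = sup_{1<t<∞} log t / log h_X(t)`. -/
def boydLower (X : RIQBFS) : ℝ :=
  ⨆ t : {t : ℝ // 1 < t}, Real.log t.1 / Real.log (X.dilNorm t.1).toReal

/-- The upper Boyd index `q_X = inf_{0<t<1} log t / log h_X(t)`. -/
def boydUpper (X : RIQBFS) : ℝ :=
  ⨅ t : {t : ℝ // 0 < t ∧ t < 1}, Real.log t.1 / Real.log (X.dilNorm t.1).toReal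

/-- `p`-convexity of `X` (as a space of functions on `ℝⁿ`). -/
def pConvex (X : RIQBFS) (n : ℕ) (p : ℝ) : Prop :=
  ∃ C : ℝ≥0∞, C ≠ ⊤ ∧ ∀ (N : ℕ) (f : Fin N → Rn n → ℝ≥0∞),
    X.normV (fun x : Rn n => (∑ j, f j x ^ p) ^ (1 / p)) ≤
      C * (∑ j, X.normV (f j) ^ p) ^ (1 / p)

end RIQBFS

/-- A rearrangement invariant Banach function space: an RIQBFS whose quasi-norm is an actual
norm satisfying the Banach function space axioms. -/
structure RIBFS extends RIQBFS where
  add_le : ∀ f g, ρ (fun t => f t + g t) ≤ ρ f + ρ g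
  indicator_lt_top : ∀ E : Set ℝ, MeasurableSet E → lebPos E < ⊤ → ρ (E.indicator 1) < ⊤
  setIntegral_le : ∀ E : Set ℝ, MeasurableSet E → lebPos E < ⊤ →
    ∃ C : ℝ≥0∞, C ≠ ⊤ ∧ ∀ f, ∫⁻ t in E, f t ∂lebPos ≤ C * ρ f

/-- The class `Φ`: nonnegative increasing functions on `[0,∞)` with `φ(0⁺)=0`, `φ(∞)=∞`. -/
def PhiClass (φ : ℝ → ℝ) : Prop :=
  (∀ ⦃s t : ℝ⦄, 0 ≤ s → s ≤ t → φ s ≤ φ t) ∧ (∀ t, 0 ≤ t → 0 ≤ φ t) ∧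
  Tendsto φ (nhdsWithin 0 (Set.Ioi 0)) (nhds 0) ∧ Tendsto φ atTop atTop

/-- Quasi-convexity: `ψ(t) ≤ φ(t) ≤ a·ψ(a·t)` for some convex `ψ` and `a ≥ 1`. -/
def QuasiConvexPhi (φ : ℝ → ℝ) : Prop :=
  ∃ (ψ : ℝ → ℝ) (a : ℝ), 1 ≤ a ∧ ConvexOn ℝ (Set.Ici 0) ψ ∧
    ∀ t, 0 ≤ t → ψ t ≤ φ t ∧ φ t ≤ a * ψ (a * t)

/-- `h_φ(t) = sup_{s>0} φ(st)/φ(s)`. -/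
def hphi (φ : ℝ → ℝ) (t : ℝ) : ℝ :=
  ⨆ s : {s : ℝ // 0 < s}, φ (s.1 * t) / φ s.1

/-- The lower dilation index `i_φ = sup_{0<t<1} log h_φ(t)/log t`. -/
def iphi (φ : ℝ → ℝ) : ℝ :=
  ⨆ t : {t : ℝ // 0 < t ∧ t < 1}, Real.log (hphi φ t.1) / Real.log t.1

/-- The upper dilation index `I_φ = inf_{1<t} log h_φ(t)/log t`. -/
def IphiUpper (φ : ℝ → ℝ) : ℝ :=
  ⨅ t : {t : ℝ // 1 < t}, Real.log (hphi φ t.1) / Real.log t.1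

/-- An `N`-function. -/
def IsNFunction (φ : ℝ → ℝ) : Prop :=
  ConvexOn ℝ (Set.Ici 0) φ ∧ (∀ ⦃s t : ℝ⦄, 0 ≤ s → s ≤ t → φ s ≤ φ t) ∧
  (∀ t, 0 ≤ t → 0 ≤ φ t) ∧ φ 0 = 0 ∧
  Tendsto (fun t => φ t / t) (nhdsWithin 0 (Set.Ioi 0)) (nhds 0) ∧
  Tendsto (fun t => φ t / t) atTop atTop

/-- The complementary (Young conjugate) function `φ̄(s) = sup_{t>0} (st − φ(t))`. -/
def complementary (φ : ℝ → ℝ) (s : ℝ) : ℝ :=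
  ⨆ t : {t : ℝ // 0 < t}, (s * t.1 - φ t.1)

/-- The modular `ρ_w^φ(g) = ∫ φ(g(x)) w(x) dx` for a nonnegative (`ℝ≥0∞`-valued) `g`. -/
def modularE (φ : ℝ → ℝ) (w : Rn n → ℝ) (g : Rn n → ℝ≥0∞) : ℝ≥0∞ :=
  ∫⁻ x, ENNReal.ofReal (φ (g x).toReal) * ENNReal.ofReal (w x)

end SparseCZ

namespace SparseCZ
variable {n : ℕ}

lemma toSet_eq (Q : Cube n) : Q.toSet =
    (WithLp.ofLp : Rn n → Fin n → ℝ) ⁻¹'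
      (Set.pi Set.univ fun i => Set.Ico (Q.corner i) (Q.corner i + Q.side)) := by
  ext x
  simp [Cube.toSet]

lemma meas_toSet (Q : Cube n) : MeasurableSet Q.toSet := by
  rw [toSet_eq]
  exact (PiLp.volume_preserving_ofLp (Fin n)).measurable
    (MeasurableSet.univ_pi fun i => measurableSet_Ico)

lemma vol_toSet (Q : Cube n) : volume Q.toSet = ENNReal.ofReal Q.side ^ n := by
  rw [toSet_eq, (PiLp.volume_preserving_ofLp (Fin n)).measure_preimage
    (MeasurableSet.univ_pi fun i => measurableSet_Ico).nullMeasurableSet, Real.volume_pi_Ico]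
  simp

lemma vol_ne_zero (Q : Cube n) : volume Q.toSet ≠ 0 := by
  rw [vol_toSet]
  exact pow_ne_zero _ (by simpa using Q.side_pos)

lemma vol_ne_top (Q : Cube n) : volume Q.toSet ≠ ⊤ := by
  rw [vol_toSet]
  exact ENNReal.pow_ne_top ENNReal.ofReal_ne_top

/-- Dyadic cell of generation `k` with index `m` relative to `Q`. -/
def cell (Q : Cube n) (k : ℕ) (m : Fin n → ℤ) : Cube n :=
  ⟨fun i => Q.corner i + m i * (Q.side / 2 ^ k), Q.side / 2 ^ k, by
    have := Q.side_pos; positivity⟩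

/-- Index of the dyadic cell containing `x`. -/
def idx (Q : Cube n) (k : ℕ) (x : Rn n) : Fin n → ℤ :=
  fun i => ⌊(x i - Q.corner i) / (Q.side / 2 ^ k)⌋

/-- Dyadic cell containing `x`. -/
def cl (Q : Cube n) (k : ℕ) (x : Rn n) : Cube n := cell Q k (idx Q k x)

lemma mem_cell (Q : Cube n) (k : ℕ) (m : Fin n → ℤ) (x : Rn n) :
    x ∈ (cell Q k m).toSet ↔ idx Q k x = m := by
  have h : 0 < Q.side / 2 ^ k := by have := Q.side_pos; positivity
  simp only [Cube.toSet, cell, Set.mem_ofPred_eq, idx, funext_iff]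
  refine forall_congr' fun i => ?_
  rw [Int.floor_eq_iff, le_div_iff₀ h, div_lt_iff₀ h]
  constructor
  · rintro ⟨h1, h2⟩
    constructor <;> linarith
  · rintro ⟨h1, h2⟩
    constructor <;> linarith

lemma mem_cl (Q : Cube n) (k : ℕ) (x : Rn n) : x ∈ (cl Q k x).toSet := (mem_cell _ _ _ _).2 rfl

lemma mem_cl_iff (Q : Cube n) (k : ℕ) (x y : Rn n) :
    y ∈ (cl Q k x).toSet ↔ idx Q k y = idx Q k x := mem_cell _ _ _ _

lemma cl_eq_of_mem {Q : Cube n} {k : ℕ} {x y : Rn n} (h : y ∈ (cl Q k x).toSet) :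
    cl Q k y = cl Q k x := by
  rw [mem_cl_iff] at h
  rw [cl, cl, h]

lemma idx_succ {Q : Cube n} {k : ℕ} {x y : Rn n} (h : idx Q (k + 1) y = idx Q (k + 1) x) :
    idx Q k y = idx Q k x := by
  have key : ∀ z : Rn n, idx Q k z = fun i => idx Q (k + 1) z i / 2 := by
    intro z
    funext i
    have := Int.floor_div_natCast ((z i - Q.corner i) / (Q.side / 2 ^ (k + 1))) 2
    simp only [idx]
    rw [Nat.cast_two] at this
    rw [show ((2 : ℕ) : ℤ) = 2 from rfl] at this
    rw [← this]
    congr 1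
    have := Q.side_pos
    rw [pow_succ]
    field_simp
  rw [key, key, h]

lemma idx_le {Q : Cube n} {j k : ℕ} (hjk : j ≤ k) {x y : Rn n} (h : idx Q k y = idx Q k x) :
    idx Q j y = idx Q j x := by
  induction k, hjk using Nat.le_induction with
  | base => exact h
  | succ k _ ih => exact ih (idx_succ h)

lemma cl_subset {Q : Cube n} {j k : ℕ} (hjk : j ≤ k) (x : Rn n) :
    (cl Q k x).toSet ⊆ (cl Q j x).toSet := fun y hy => by
  rw [mem_cl_iff] at hy ⊢
  exact idx_le hjk hy

lemma cl_zero {Q : Cube n} {x : Rn n} (hx : x ∈ Q.toSet) : cl Q 0 x = Q := by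
  have h0 : cell Q 0 0 = Q := by
    cases Q
    simp [cell]
  have : idx Q 0 x = 0 := by
    rw [← mem_cell, h0]; exact hx
  rw [cl, this, h0]

lemma cl_subset_Q {Q : Cube n} {x : Rn n} (hx : x ∈ Q.toSet) (k : ℕ) :
    (cl Q k x).toSet ⊆ Q.toSet := by
  have := cl_subset (Q := Q) (Nat.zero_le k) x
  rwa [cl_zero hx] at this

lemma vol_cl (Q : Cube n) (k : ℕ) (x : Rn n) :
    volume (cl Q k x).toSet = ENNReal.ofReal (Q.side / 2 ^ k) ^ n := vol_toSet _

lemma vol_cl_succ (Q : Cube n) (k : ℕ) (x : Rn n) :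
    volume (cl Q k x).toSet = 2 ^ n * volume (cl Q (k + 1) x).toSet := by
  rw [vol_cl, vol_cl, ← mul_pow, ← ENNReal.ofReal_ofNat 2, ← ENNReal.ofReal_mul (by norm_num)]
  congr 2
  rw [pow_succ]; field_simp

lemma lint_le {Q : Cube n} {F G : Rn n → ℝ≥0∞} (k : ℕ)
    (h : ∀ x ∈ Q.toSet, ∫⁻ y in (cl Q k x).toSet, F y ≤ ∫⁻ y in (cl Q k x).toSet, G y) :
    ∫⁻ y in Q.toSet, F y ≤ ∫⁻ y in Q.toSet, G y := by
  have hU : Q.toSet = ⋃ m : Fin n → ℤ, Q.toSet ∩ (cell Q k m).toSet := by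
    ext x
    simp only [mem_iUnion, mem_inter_iff, exists_and_left, iff_self_and]
    intro _
    exact ⟨_, mem_cl Q k x⟩
  have hm : ∀ m : Fin n → ℤ, MeasurableSet (Q.toSet ∩ (cell Q k m).toSet) :=
    fun m => (meas_toSet _).inter (meas_toSet _)
  have hd : Pairwise (Function.onFun Disjoint fun m : Fin n → ℤ => Q.toSet ∩ (cell Q k m).toSet) := by
    intro m m' hmm
    refine Set.disjoint_left.2 fun x hx hx' => hmm ?_
    rw [← (mem_cell _ _ _ _).1 hx.2, ← (mem_cell _ _ _ _).1 hx'.2]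
  rw [hU, lintegral_iUnion hm hd, lintegral_iUnion hm hd]
  refine ENNReal.tsum_le_tsum fun m => ?_
  rcases (Q.toSet ∩ (cell Q k m).toSet).eq_empty_or_nonempty with he | ⟨x, hx⟩
  · simp [he]
  · have hc : cl Q k x = cell Q k m := by rw [cl, (mem_cell _ _ _ _).1 hx.2]
    have : Q.toSet ∩ (cell Q k m).toSet = (cl Q k x).toSet := by
      rw [← hc]
      exact inter_eq_right.2 (cl_subset_Q hx.1 k)
    rw [this]
    exact h x hx.1

/-- dyadic averages -/
def av (s : Rn n → ℝ≥0∞) (Q : Cube n) (k : ℕ) (x : Rn n) : ℝ≥0∞ := avgE (cl Q k x).toSet s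

/-- running maximum -/
def mx (a : ℕ → Rn n → ℝ≥0∞) : ℕ → Rn n → ℝ≥0∞
  | 0, x => a 0 x
  | k + 1, x => max (mx a k x) (a (k + 1) x)

lemma measurable_idx (Q : Cube n) (k : ℕ) : Measurable (idx Q k) := by
  refine measurable_pi_lambda _ fun i => ?_
  refine Int.measurable_floor.comp ?_
  have : Measurable fun x : Rn n => x i := by fun_prop
  fun_prop

lemma measurable_av (s : Rn n → ℝ≥0∞) (Q : Cube n) (k : ℕ) : Measurable (av s Q k) := by
  have : av s Q k = (fun m => avgE (cell Q k m).toSet s) ∘ idx Q k := rfl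
  rw [this]
  exact (measurable_of_countable _).comp (measurable_idx Q k)

lemma measurable_mx {a : ℕ → Rn n → ℝ≥0∞} (h : ∀ k, Measurable (a k)) (k : ℕ) :
    Measurable (mx a k) := by
  induction k with
  | zero => exact h 0
  | succ k ih => exact ih.max (h (k + 1))

lemma mx_mono (a : ℕ → Rn n → ℝ≥0∞) (x : Rn n) : Monotone fun k => mx a k x :=
  monotone_nat_of_le_succ fun _ => le_max_left _ _

lemma le_mx (a : ℕ → Rn n → ℝ≥0∞) (k : ℕ) (x : Rn n) : a k x ≤ mx a k x := by
  cases k with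
  | zero => exact le_rfl
  | succ k => exact le_max_right _ _

lemma mx_le {a : ℕ → Rn n → ℝ≥0∞} {k : ℕ} {x : Rn n} {C : ℝ≥0∞} (h : ∀ j ≤ k, a j x ≤ C) :
    mx a k x ≤ C := by
  induction k with
  | zero => exact h 0 le_rfl
  | succ k ih => exact max_le (ih fun j hj => h j (by omega)) (h _ le_rfl)

lemma av_congr (s : Rn n → ℝ≥0∞) {Q : Cube n} {k : ℕ} {x y : Rn n}
    (h : y ∈ (cl Q k x).toSet) : av s Q k y = av s Q k x := by
  rw [av, av, cl_eq_of_mem h]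

lemma mx_congr {a : ℕ → Rn n → ℝ≥0∞} {Q : Cube n}
    (ha : ∀ k x y, y ∈ (cl Q k x).toSet → a k y = a k x) {k : ℕ} {x y : Rn n}
    (h : y ∈ (cl Q k x).toSet) : mx a k y = mx a k x := by
  induction k with
  | zero => exact ha 0 x y h
  | succ k ih =>
    simp only [mx]
    rw [ih (cl_subset (Nat.le_succ k) x h), ha _ _ _ h]

lemma avgE_mul_vol (Q : Cube n) (s : Rn n → ℝ≥0∞) :
    avgE Q.toSet s * volume Q.toSet = ∫⁻ x in Q.toSet, s x := by
  rw [avgE, mul_comm, ← mul_assoc, ENNReal.mul_inv_cancel (vol_ne_zero Q) (vol_ne_top Q), one_mul]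

lemma avgE_le_mul {P R : Cube n} {C : ℝ≥0∞} (hRP : R.toSet ⊆ P.toSet) (s : Rn n → ℝ≥0∞)
    (hv : volume P.toSet ≤ C * volume R.toSet) : avgE R.toSet s ≤ C * avgE P.toSet s := by
  rw [avgE, avgE, ← mul_assoc]
  gcongr
  rw [← div_eq_mul_inv, ENNReal.le_div_iff_mul_le (Or.inl (vol_ne_zero P)) (Or.inl (vol_ne_top P)),
    mul_comm, ← div_eq_mul_inv]
  exact ENNReal.div_le_of_le_mul hv

lemma av_succ_le (s : Rn n → ℝ≥0∞) (Q : Cube n) (k : ℕ) (x : Rn n) :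
    av s Q (k + 1) x ≤ 2 ^ n * av s Q k x :=
  avgE_le_mul (cl_subset (Nat.le_succ k) x) s (vol_cl_succ Q k x).le

/-- uniform finite bound for the running maximum of averages -/
lemma exists_bound {s : Rn n → ℝ≥0∞} {Q : Cube n} (hs : ∫⁻ x in Q.toSet, s x ≠ ⊤) (k : ℕ) :
    ∃ B : ℝ≥0∞, B ≠ ⊤ ∧ ∀ x ∈ Q.toSet, mx (av s Q) k x ≤ B := by
  refine ⟨(2 ^ n) ^ k * avgE Q.toSet s, ?_, fun x hx => ?_⟩
  · refine ENNReal.mul_ne_top (by finiteness) ?_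
    exact ENNReal.mul_ne_top (ENNReal.inv_ne_top.2 (vol_ne_zero Q)) hs
  · have key : ∀ j, av s Q j x ≤ (2 ^ n) ^ j * avgE Q.toSet s := by
      intro j
      induction j with
      | zero => simp [av, cl_zero hx]
      | succ j ih =>
        refine (av_succ_le s Q j x).trans ?_
        rw [pow_succ', mul_assoc]
        gcongr
    refine mx_le fun j hj => (key j).trans ?_
    gcongr
    exact one_le_pow₀ (by norm_num)

lemma telescope {f g : ℕ → ℝ≥0∞} (hg : ∀ k, g k ≠ ⊤) (N : ℕ)
    (h : ∀ k < N, f (k + 1) + g k ≤ f k + g (k + 1)) : f N + g 0 ≤ f 0 + g N := by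
  induction N with
  | zero => exact le_rfl
  | succ k ih =>
    have ih' := ih fun j hj => h j (by omega)
    rw [← ENNReal.add_le_add_iff_right (hg k)]
    calc f (k + 1) + g 0 + g k = (f (k + 1) + g k) + g 0 := by ring
      _ ≤ f k + g (k + 1) + g 0 := add_le_add (h k (by omega)) le_rfl
      _ = (f k + g 0) + g (k + 1) := by ring
      _ ≤ f 0 + g k + g (k + 1) := by gcongr
      _ = _ := by ring

end SparseCZ

namespace SparseCZ
variable {n : ℕ}

lemma elem_real {a b C ε : ℝ} (ha : 0 ≤ a) (hab : a ≤ b) (hb : b ≤ C * a) (hε : 0 < ε) :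
    b ^ ε * b + C * ε / (1 + ε) * a ^ (1 + ε) ≤ a ^ ε * b + C * ε / (1 + ε) * b ^ (1 + ε) := by
  rcases ha.eq_or_lt with rfl | ha
  · have : b = 0 := le_antisymm (by simpa using hb) hab
    subst this; exact le_rfl
  have hC : 0 ≤ C := by
    by_contra h
    push Not at h
    nlinarith
  have hmono : MonotoneOn (fun t : ℝ => C * ε / (1 + ε) * t ^ (1 + ε) - b * t ^ ε) (Set.Icc a b) := by
    have hd : ∀ t ∈ Set.Icc a b, HasDerivAt
        (fun t : ℝ => C * ε / (1 + ε) * t ^ (1 + ε) - b * t ^ ε)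
        (C * ε / (1 + ε) * ((1 + ε) * t ^ (1 + ε - 1)) - b * (ε * t ^ (ε - 1))) t := by
      intro t ht
      have ht0 : t ≠ 0 := (ha.trans_le ht.1).ne'
      exact ((Real.hasDerivAt_rpow_const (Or.inl ht0)).const_mul _).sub
        ((Real.hasDerivAt_rpow_const (Or.inl ht0)).const_mul _)
    refine monotoneOn_of_deriv_nonneg (convex_Icc a b) ?_ ?_ ?_
    · exact fun t ht => (hd t ht).continuousAt.continuousWithinAt
    · exact fun t ht => (hd t (interior_subset ht)).differentiableAt.differentiableWithinAt
    · intro t ht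
      have ht' := interior_subset ht
      have ht0 : 0 < t := ha.trans_le ht'.1
      rw [(hd t ht').deriv]
      have e1 : t ^ (1 + ε - 1) = t ^ (ε - 1) * t := by
        rw [← Real.rpow_add_one ht0.ne']; congr 1; ring
      rw [e1]
      have : C * ε / (1 + ε) * ((1 + ε) * (t ^ (ε - 1) * t)) - b * (ε * t ^ (ε - 1))
          = ε * t ^ (ε - 1) * (C * t - b) := by
        field_simp
      rw [this]
      have h2 : 0 ≤ C * t - b := by nlinarith [mul_le_mul_of_nonneg_left ht'.1 hC]
      positivity
  have := hmono (Set.left_mem_Icc.2 hab) (Set.right_mem_Icc.2 hab) hab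
  simp only at this
  linarith [mul_comm b (a ^ ε), mul_comm b (b ^ ε)]

lemma elem_enn {a b X v K : ℝ≥0∞} {ε : ℝ} (hab : a ≤ b) (hb : b ≤ 2 ^ n * a)
    (hbt : b ≠ ⊤) (hε : 0 < ε) (hX : X ≤ K * (b * v)) :
    b ^ ε * X + K * ENNReal.ofReal (2 ^ n * ε / (1 + ε)) * (a ^ (1 + ε) * v) ≤
      a ^ ε * X + K * ENNReal.ofReal (2 ^ n * ε / (1 + ε)) * (b ^ (1 + ε) * v) := by
  set c := ENNReal.ofReal (2 ^ n * ε / (1 + ε)) with hc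
  have hat : a ≠ ⊤ := ne_top_of_le_ne_top hbt hab
  have key : b ^ ε * b + c * a ^ (1 + ε) ≤ a ^ ε * b + c * b ^ (1 + ε) := by
    lift a to ℝ≥0 using hat
    lift b to ℝ≥0 using hbt
    have h1 : (a : ℝ) ≤ b := by exact_mod_cast hab
    have h2 : (b : ℝ) ≤ 2 ^ n * a := by exact_mod_cast hb
    have := elem_real a.2 h1 h2 hε
    have hc' : c = ((2 ^ n * ε / (1 + ε)).toNNReal : ℝ≥0) := rfl
    have h0 : 0 ≤ 2 ^ n * ε / (1 + ε) := by positivity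
    rw [hc', ← ENNReal.coe_rpow_of_nonneg _ hε.le, ← ENNReal.coe_rpow_of_nonneg _ hε.le,
      ← ENNReal.coe_rpow_of_nonneg _ (by positivity), ← ENNReal.coe_rpow_of_nonneg _ (by positivity)]
    norm_cast
    rw [← NNReal.coe_le_coe]
    push_cast
    rw [Real.coe_toNNReal _ h0]
    exact this
  have hd : a ^ ε ≤ b ^ ε := ENNReal.rpow_le_rpow hab hε.le
  obtain ⟨d, hd'⟩ := exists_add_of_le hd
  have hat' : a ^ ε * b ≠ ⊤ := ENNReal.mul_ne_top (ENNReal.rpow_ne_top_of_nonneg hε.le hat) hbt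
  have key2 : d * b + c * a ^ (1 + ε) ≤ c * b ^ (1 + ε) := by
    rw [hd', add_mul, add_assoc] at key
    exact (ENNReal.add_le_add_iff_left hat').1 key
  rw [hd']
  calc (a ^ ε + d) * X + K * c * (a ^ (1 + ε) * v)
      = a ^ ε * X + (d * X + K * c * (a ^ (1 + ε) * v)) := by ring
    _ ≤ a ^ ε * X + (d * (K * (b * v)) + K * c * (a ^ (1 + ε) * v)) := by gcongr
    _ = a ^ ε * X + K * v * (d * b + c * a ^ (1 + ε)) := by ring
    _ ≤ a ^ ε * X + K * v * (c * b ^ (1 + ε)) := by gcongr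
    _ = _ := by ring

lemma mx_av_congr (s : Rn n → ℝ≥0∞) {Q : Cube n} {k : ℕ} {x y : Rn n}
    (h : y ∈ (cl Q k x).toSet) : mx (av s Q) k y = mx (av s Q) k x := by
  have h1 : ∀ j z y, y ∈ (cl Q j z).toSet → av s Q j y = av s Q j z :=
    fun j z y h => av_congr s h
  exact mx_congr h1 h

lemma lemA {s g : Rn n → ℝ≥0∞} (hg : Measurable g) {Q : Cube n}
    (hs : ∫⁻ x in Q.toSet, s x ≠ ⊤) {K : ℝ≥0∞} (hKt : K ≠ ⊤) {ε : ℝ} (hε : 0 < ε) (N : ℕ)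
    (hK : ∀ k ≤ N, ∀ x ∈ Q.toSet, mx (av s Q) k x = av s Q k x →
      ∫⁻ y in (cl Q k x).toSet, g y ≤ K * ∫⁻ y in (cl Q k x).toSet, s y) :
    ∫⁻ x in Q.toSet, mx (av s Q) N x ^ ε * g x ≤
      avgE Q.toSet s ^ ε * (∫⁻ x in Q.toSet, g x) +
        K * ENNReal.ofReal (2 ^ n * ε / (1 + ε)) * ∫⁻ x in Q.toSet, mx (av s Q) N x ^ (1 + ε) := by
  set c := ENNReal.ofReal (2 ^ n * ε / (1 + ε)) with hc
  have hM : ∀ k, Measurable (mx (av s Q) k) := measurable_mx (measurable_av s Q)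
  have hfin : ∀ k, K * c * ∫⁻ x in Q.toSet, mx (av s Q) k x ^ (1 + ε) ≠ ⊤ := by
    intro k
    obtain ⟨B, hB, hB'⟩ := exists_bound hs k
    refine ENNReal.mul_ne_top (ENNReal.mul_ne_top hKt ENNReal.ofReal_ne_top) ?_
    refine ne_top_of_le_ne_top (b := B ^ (1 + ε) * volume Q.toSet) ?_ ?_
    · exact ENNReal.mul_ne_top (ENNReal.rpow_ne_top_of_nonneg (by positivity) hB) (vol_ne_top Q)
    · rw [← setLIntegral_const]
      refine setLIntegral_mono measurable_const fun x hx => ?_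
      exact ENNReal.rpow_le_rpow (hB' x hx) (by positivity)
  have := telescope (f := fun k => ∫⁻ x in Q.toSet, mx (av s Q) k x ^ ε * g x) hfin N ?_
  · refine le_trans (le_trans le_self_add this) ?_
    gcongr
    rw [← lintegral_const_mul _ hg]
    refine (setLIntegral_congr_fun (meas_toSet Q) fun x hx => ?_).le
    simp [mx, av, cl_zero hx]
  · intro k hk
    rw [← lintegral_const_mul _ ((hM _).pow_const _), ← lintegral_const_mul _ ((hM _).pow_const _),
      ← lintegral_add_right _ (((hM _).pow_const _).const_mul _),
      ← lintegral_add_right _ (((hM _).pow_const _).const_mul _)]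
    refine lint_le (k + 1) fun x hx => ?_
    set R := (cl Q (k + 1) x).toSet with hR
    have hRm : MeasurableSet R := meas_toSet _
    set a := mx (av s Q) k x with ha
    set b := mx (av s Q) (k + 1) x with hb
    have e1 : ∀ y ∈ R, mx (av s Q) k y = a := fun y hy =>
      mx_av_congr s (cl_subset (Nat.le_succ k) x hy)
    have e2 : ∀ y ∈ R, mx (av s Q) (k + 1) y = b := fun y hy =>
      mx_av_congr s hy
    have L : ∫⁻ y in R, mx (av s Q) (k + 1) y ^ ε * g y + K * c * mx (av s Q) k y ^ (1 + ε)
        = b ^ ε * (∫⁻ y in R, g y) + K * c * (a ^ (1 + ε) * volume R) := by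
      rw [← mul_assoc, ← setLIntegral_const, ← lintegral_const_mul _ hg,
        ← lintegral_add_right _ measurable_const]
      refine setLIntegral_congr_fun hRm fun y hy => ?_
      simp only [e1 y hy, e2 y hy]
    have L' : ∫⁻ y in R, mx (av s Q) k y ^ ε * g y + K * c * mx (av s Q) (k + 1) y ^ (1 + ε)
        = a ^ ε * (∫⁻ y in R, g y) + K * c * (b ^ (1 + ε) * volume R) := by
      rw [← mul_assoc, ← setLIntegral_const, ← lintegral_const_mul _ hg,
        ← lintegral_add_right _ measurable_const]
      refine setLIntegral_congr_fun hRm fun y hy => ?_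
      simp only [e1 y hy, e2 y hy]
    rw [L, L']
    rcases le_or_gt (av s Q (k + 1) x) a with h | h
    · have : b = a := max_eq_left h
      rw [this]
    · have hba : b = av s Q (k + 1) x := max_eq_right h.le
      obtain ⟨B, hB, hB'⟩ := exists_bound hs (k + 1)
      refine elem_enn (mx_mono _ x (Nat.le_succ k)) ?_ (ne_top_of_le_ne_top hB (hB' x hx)) hε ?_
      · rw [hba]
        exact (av_succ_le s Q k x).trans (by gcongr; exact le_mx _ _ _)
      · have := hK (k + 1) hk x hx hba
        rw [hba]
        rwa [← avgE_mul_vol _ s] at this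

/-- Reverse Hölder at finite generation. -/
lemma RH_fin {s : Rn n → ℝ≥0∞} (hsm : Measurable s) {Q : Cube n}
    (hs : ∫⁻ x in Q.toSet, s x ≠ ⊤) {K : ℝ} (hK0 : 0 < K) (N : ℕ)
    (hK : ∀ k ≤ N, ∀ x ∈ Q.toSet, mx (av s Q) k x = av s Q k x →
      ∫⁻ y in (cl Q k x).toSet, mx (av s Q) N y ≤
        ENNReal.ofReal K * ∫⁻ y in (cl Q k x).toSet, s y) {ε : ℝ}
    (hε : ε = 1 / (2 ^ (n + 1) * K))
    (hK' : ∫⁻ y in Q.toSet, mx (av s Q) N y ≤ ENNReal.ofReal K * ∫⁻ y in Q.toSet, s y) :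
    ∫⁻ x in Q.toSet, mx (av s Q) N x ^ ε * s x ≤
      2 * (avgE Q.toSet s ^ ε * ∫⁻ x in Q.toSet, s x) := by
  have hε0 : 0 < ε := by rw [hε]; positivity
  have h1 := lemA (measurable_mx (measurable_av s Q) N) hs (ENNReal.ofReal_ne_top (r := K)) hε0 N hK
  have h2 := lemA hsm hs ENNReal.one_ne_top hε0 N (fun k _ x _ _ => (one_mul _).ge)
  set c := ENNReal.ofReal (2 ^ n * ε / (1 + ε)) with hc
  have hY : ∫⁻ x in Q.toSet, mx (av s Q) N x ^ ε * mx (av s Q) N x =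
      ∫⁻ x in Q.toSet, mx (av s Q) N x ^ (1 + ε) := by
    refine lintegral_congr fun x => ?_
    rw [add_comm 1 ε, ENNReal.rpow_add_of_nonneg _ _ hε0.le zero_le_one, ENNReal.rpow_one]
  rw [hY] at h1
  set Y := ∫⁻ x in Q.toSet, mx (av s Q) N x ^ (1 + ε) with hYdef
  have hYt : Y ≠ ⊤ := by
    obtain ⟨B, hB, hB'⟩ := exists_bound hs N
    refine ne_top_of_le_ne_top (b := B ^ (1 + ε) * volume Q.toSet) ?_ ?_
    · exact ENNReal.mul_ne_top (ENNReal.rpow_ne_top_of_nonneg (by positivity) hB) (vol_ne_top Q)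
    · rw [← setLIntegral_const]
      refine setLIntegral_mono measurable_const fun x hx => ?_
      exact ENNReal.rpow_le_rpow (hB' x hx) (by positivity)
  have hKc : ENNReal.ofReal K * c ≤ 2⁻¹ := by
    rw [hc, ← ENNReal.ofReal_mul hK0.le, ← ENNReal.ofReal_ofNat 2,
      ← ENNReal.ofReal_inv_of_pos (by norm_num)]
    refine ENNReal.ofReal_le_ofReal ?_
    have : K * (2 ^ n * ε / (1 + ε)) = 2⁻¹ * (1 / (1 + ε)) := by
      have : 2 ^ (n + 1) * K * ε = 1 := by rw [hε]; field_simp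
      field_simp
      rw [pow_succ] at this
      linarith
    rw [this]
    have : 1 / (1 + ε) ≤ 1 := by rw [div_le_one (by positivity)]; linarith
    linarith
  set Z := avgE Q.toSet s ^ ε * ∫⁻ x in Q.toSet, s x with hZ
  have h3 : Y ≤ ENNReal.ofReal K * Z + 2⁻¹ * Y := by
    refine h1.trans ?_
    refine add_le_add ?_ (by gcongr)
    calc _ ≤ avgE Q.toSet s ^ ε * (ENNReal.ofReal K * ∫⁻ y in Q.toSet, s y) := by gcongr
      _ = _ := by rw [hZ]; ring
  have h4 : 2⁻¹ * Y ≤ ENNReal.ofReal K * Z := by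
    have hY2 : Y = 2⁻¹ * Y + 2⁻¹ * Y := by
      rw [← add_mul, ENNReal.inv_two_add_inv_two, one_mul]
    have : 2⁻¹ * Y + 2⁻¹ * Y ≤ ENNReal.ofReal K * Z + 2⁻¹ * Y := by rw [← hY2]; exact h3
    exact (ENNReal.add_le_add_iff_right (ENNReal.mul_ne_top (by simp) hYt)).1 this
  have h5 : Y ≤ 2 * (ENNReal.ofReal K * Z) := by
    calc Y = 2 * (2⁻¹ * Y) := by
          rw [← mul_assoc, ENNReal.mul_inv_cancel (by norm_num) (by norm_num), one_mul]
      _ ≤ _ := by gcongr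
  calc _ ≤ Z + 1 * c * Y := h2
    _ ≤ Z + 1 * c * (2 * (ENNReal.ofReal K * Z)) := by gcongr
    _ = Z + 2 * (ENNReal.ofReal K * c) * Z := by ring
    _ ≤ Z + 2 * 2⁻¹ * Z := by gcongr
    _ = 2 * Z := by rw [ENNReal.mul_inv_cancel (by norm_num) (by norm_num)]; ring

end SparseCZ

namespace SparseCZ
variable {n : ℕ}

lemma lebesgue_cells {s : Rn n → ℝ≥0∞} (hsm : Measurable s) {Q : Cube n}
    (hs : ∫⁻ x in Q.toSet, s x ≠ ⊤) :
    ∀ᵐ x ∂(volume : Measure (Rn n)), x ∈ Q.toSet → s x ≤ ⨆ k, mx (av s Q) k x := by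
  set T : (Fin n → ℝ) → Rn n := WithLp.toLp 2 with hT
  have hTp : MeasurePreserving T volume volume := PiLp.volume_preserving_toLp (Fin n)
  have hindm : Measurable (Q.toSet.indicator s) := hsm.indicator (meas_toSet Q)
  set f : (Fin n → ℝ) → ℝ≥0∞ := fun y => Q.toSet.indicator s (T y) with hf
  have hfm : Measurable f := hindm.comp hTp.measurable
  have hfi : ∫⁻ y, f y ≠ ⊤ := by
    rw [hf, hTp.lintegral_comp hindm, lintegral_indicator (meas_toSet Q)]
    exact hs
  have hae := (IsUnifLocDoublingMeasure.vitaliFamily (volume : Measure (Fin n → ℝ)) 1).ae_tendsto_lintegral_div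
    hfm.aemeasurable hfi
  have hae2 := (PiLp.volume_preserving_ofLp (Fin n)).quasiMeasurePreserving.ae hae
  filter_upwards [hae2] with x hx hxQ
  set h : ℕ → ℝ := fun k => Q.side / 2 ^ k with hh
  have hpos : ∀ k, 0 < h k := fun k => by have := Q.side_pos; simp only [hh]; positivity
  set c : ℕ → (Fin n → ℝ) := fun k i => Q.corner i + idx Q k x i * h k + h k / 2 with hc
  have hball : ∀ k, Metric.closedBall (c k) (h k / 2) =
      Set.pi Set.univ fun i => Set.Icc ((cl Q k x).corner i) ((cl Q k x).corner i + (cl Q k x).side) := by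
    intro k
    rw [closedBall_pi _ (by have := hpos k; positivity)]
    congr 1
    funext i
    rw [Real.closedBall_eq_Icc]
    simp only [hc, cl, cell, hh]
    congr 1 <;> ring
  have hcl : ∀ k, (cl Q k x).toSet = (WithLp.ofLp : Rn n → Fin n → ℝ) ⁻¹'
      (Set.pi Set.univ fun i => Set.Ico ((cl Q k x).corner i) ((cl Q k x).corner i + (cl Q k x).side)) :=
    fun k => toSet_eq _
  have hpre : ∀ k, T ⁻¹' (cl Q k x).toSet =
      (Set.pi Set.univ fun i => Set.Ico ((cl Q k x).corner i) ((cl Q k x).corner i + (cl Q k x).side)) := by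
    intro k
    rw [hcl k]
    rfl
  have haeq : ∀ k, Metric.closedBall (c k) (h k / 2) =ᵐ[volume] T ⁻¹' (cl Q k x).toSet := by
    intro k
    rw [hball, hpre]
    exact (Measure.pi_Ico_ae_eq_pi_Icc (μ := fun _ => volume)).symm
  have hval : ∀ k, (∫⁻ y in Metric.closedBall (c k) (h k / 2), f y) /
      volume (Metric.closedBall (c k) (h k / 2)) = av s Q k x := by
    intro k
    rw [setLIntegral_congr (haeq k), measure_congr (haeq k),
      hTp.measure_preimage (meas_toSet _).nullMeasurableSet, hf,
      hTp.setLIntegral_comp_preimage (meas_toSet _) hindm, av, avgE, ENNReal.div_eq_inv_mul]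
    congr 1
    refine setLIntegral_congr_fun (meas_toSet _) fun y hy => ?_
    exact indicator_of_mem (cl_subset_Q hxQ k hy) _
  have hlim : Tendsto (fun k => Metric.closedBall (c k) (h k / 2)) atTop
      ((IsUnifLocDoublingMeasure.vitaliFamily (volume : Measure (Fin n → ℝ)) 1).filterAt
        (WithLp.ofLp x)) := by
    refine IsUnifLocDoublingMeasure.tendsto_closedBall_filterAt _ _ _ ?_ ?_
    · refine tendsto_nhdsWithin_iff.2 ⟨?_, Eventually.of_forall fun k => half_pos (hpos k)⟩
      have : Tendsto (fun k : ℕ => Q.side / 2 * (1 / 2 : ℝ) ^ k) atTop (𝓝 (Q.side / 2 * 0)) :=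
        (tendsto_pow_atTop_nhds_zero_of_lt_one (by norm_num) (by norm_num)).const_mul _
      rw [mul_zero] at this
      refine this.congr fun k => ?_
      simp only [hh]
      rw [one_div, inv_pow]; field_simp
    · refine Eventually.of_forall fun k => ?_
      rw [one_mul, hball]
      intro i _
      have := mem_cl Q k x i
      exact ⟨this.1, this.2.le⟩
  have hfin := hx.comp hlim
  have hfx : f (WithLp.ofLp x) = s x := indicator_of_mem hxQ _
  rw [hfx] at hfin
  refine le_of_tendsto hfin (Eventually.of_forall fun k => ?_)
  simp only [Function.comp]
  rw [hval k]
  exact (le_mx _ _ _).trans (le_iSup (fun k => mx (av s Q) k x) k)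

lemma RH {s : Rn n → ℝ≥0∞} (hsm : Measurable s) {Q : Cube n}
    (hs : ∫⁻ x in Q.toSet, s x ≠ ⊤) {K : ℝ} (hK0 : 0 < K)
    (hK : ∀ N, ∀ k ≤ N, ∀ x ∈ Q.toSet, mx (av s Q) k x = av s Q k x →
      ∫⁻ y in (cl Q k x).toSet, mx (av s Q) N y ≤
        ENNReal.ofReal K * ∫⁻ y in (cl Q k x).toSet, s y) {ε : ℝ}
    (hε : ε = 1 / (2 ^ (n + 1) * K)) :
    avgE Q.toSet (fun x => s x ^ (1 + ε)) ≤ 2 * avgE Q.toSet s ^ (1 + ε) := by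
  have hε0 : 0 < ε := by rw [hε]; positivity
  have hM : ∀ k, Measurable (mx (av s Q) k) := measurable_mx (measurable_av s Q)
  set Z := avgE Q.toSet s ^ ε * ∫⁻ x in Q.toSet, s x with hZ
  have h1 : ∫⁻ x in Q.toSet, s x ^ (1 + ε) ≤ 2 * Z := by
    calc ∫⁻ x in Q.toSet, s x ^ (1 + ε)
        ≤ ∫⁻ x in Q.toSet, ⨆ N, mx (av s Q) N x ^ ε * s x := by
          refine setLIntegral_mono_ae' (meas_toSet Q) ?_
          filter_upwards [lebesgue_cells hsm hs] with x hx hxQ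
          rw [← ENNReal.iSup_mul, add_comm 1 ε,
            ENNReal.rpow_add_of_nonneg _ _ hε0.le zero_le_one, ENNReal.rpow_one]
          gcongr
          have : (⨆ N, mx (av s Q) N x ^ ε) = (⨆ N, mx (av s Q) N x) ^ ε :=
            ((ENNReal.orderIsoRpow ε hε0).map_iSup _).symm
          rw [this]
          exact ENNReal.rpow_le_rpow (hx hxQ) hε0.le
      _ = ⨆ N, ∫⁻ x in Q.toSet, mx (av s Q) N x ^ ε * s x := by
          refine lintegral_iSup (fun N => ((hM N).pow_const _).mul hsm) ?_
          intro i j hij x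
          have := mx_mono (av s Q) x hij
          simp only at this ⊢
          gcongr
      _ ≤ 2 * Z := by
          refine iSup_le fun N => RH_fin hsm hs hK0 N (hK N) hε ?_
          have hx : (WithLp.toLp 2 Q.corner : Rn n) ∈ Q.toSet := fun i =>
            ⟨le_rfl, by have := Q.side_pos; simpa using this⟩
          have := hK N 0 (Nat.zero_le N) _ hx rfl
          rwa [cl_zero hx] at this
  have h2 : avgE Q.toSet s ^ (1 + ε) = avgE Q.toSet s ^ ε * avgE Q.toSet s := by
    rw [add_comm 1 ε, ENNReal.rpow_add_of_nonneg _ _ hε0.le zero_le_one, ENNReal.rpow_one]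
  rw [h2]
  calc avgE Q.toSet (fun x => s x ^ (1 + ε)) ≤ (volume Q.toSet)⁻¹ * (2 * Z) := by
        rw [avgE]; gcongr
    _ = 2 * (avgE Q.toSet s ^ ε * ((volume Q.toSet)⁻¹ * ∫⁻ x in Q.toSet, s x)) := by
        rw [hZ]; ring
    _ = _ := rfl

end SparseCZ

namespace SparseCZ
variable {n : ℕ}

lemma int_ne_zero {W : Rn n → ℝ≥0∞} (hWm : Measurable W) (hW0 : ∀ x, W x ≠ 0) (R : Cube n) :
    ∫⁻ x in R.toSet, W x ≠ 0 := by
  rw [Ne, lintegral_eq_zero_iff hWm]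
  intro h
  have : volume.restrict R.toSet Set.univ = 0 := by
    have h2 := ae_iff.1 h
    convert! h2 using 2
    ext x; simpa using hW0 x
  rw [Measure.restrict_apply_univ] at this
  exact vol_ne_zero R this

lemma avg_ne_zero {W : Rn n → ℝ≥0∞} (hWm : Measurable W) (hW0 : ∀ x, W x ≠ 0) (R : Cube n) :
    avgE R.toSet W ≠ 0 :=
  mul_ne_zero (ENNReal.inv_ne_zero.2 (vol_ne_top R)) (int_ne_zero hWm hW0 R)

lemma avg_ne_top {W : Rn n → ℝ≥0∞} {R : Cube n} (h : ∫⁻ x in R.toSet, W x ≠ ⊤) :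
    avgE R.toSet W ≠ ⊤ :=
  ENNReal.mul_ne_top (ENNReal.inv_ne_top.2 (vol_ne_zero R)) h

lemma int_ne_top {s : Rn n → ℝ≥0∞} {R : Cube n} (h : avgE R.toSet s ≠ ⊤) :
    ∫⁻ x in R.toSet, s x ≠ ⊤ := by
  rw [← avgE_mul_vol]
  exact ENNReal.mul_ne_top h (vol_ne_top R)

lemma hol {W : Rn n → ℝ≥0∞} (hWm : Measurable W) (hW0 : ∀ x, W x ≠ 0) (hWt : ∀ x, W x ≠ ⊤)
    {p : ℝ} (hp : 1 < p) (R : Cube n) :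
    1 ≤ avgE R.toSet W * avgE R.toSet (fun x => W x ^ (-(1 / (p - 1)))) ^ (p - 1) := by
  set s : Rn n → ℝ≥0∞ := fun x => W x ^ (-(1 / (p - 1))) with hs
  have hp0 : 0 < p := by linarith
  have hp1 : 0 < p - 1 := by linarith
  have hpq : p.HolderConjugate (p / (p - 1)) := Real.HolderConjugate.conjExponent hp
  have h := ENNReal.lintegral_mul_le_Lp_mul_Lq (volume.restrict R.toSet) hpq
    (f := fun x => W x ^ (1 / p)) (g := fun x => W x ^ (-(1 / p)))
    (hWm.pow_const _).aemeasurable (hWm.pow_const _).aemeasurable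
  have e1 : ∀ x, (W x ^ (1 / p)) ^ p = W x := fun x => by
    rw [← ENNReal.rpow_mul, one_div_mul_cancel hp0.ne', ENNReal.rpow_one]
  have e2 : ∀ x, (W x ^ (-(1 / p))) ^ (p / (p - 1)) = s x := fun x => by
    rw [← ENNReal.rpow_mul, hs]
    congr 1
    field_simp
  have e3 : ∀ x, W x ^ (1 / p) * W x ^ (-(1 / p)) = 1 := fun x => by
    rw [← ENNReal.rpow_add _ _ (hW0 x) (hWt x)]; simp
  simp only [Pi.mul_apply, e1, e2, e3, lintegral_one, Measure.restrict_apply_univ] at h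
  have h' := ENNReal.rpow_le_rpow h hp0.le
  rw [ENNReal.mul_rpow_of_nonneg _ _ hp0.le, ← ENNReal.rpow_mul, ← ENNReal.rpow_mul,
    one_div_mul_cancel hp0.ne', ENNReal.rpow_one,
    show 1 / (p / (p - 1)) * p = p - 1 by field_simp, ← avgE_mul_vol, ← avgE_mul_vol,
    ENNReal.mul_rpow_of_nonneg _ _ hp1.le] at h'
  have hv : volume R.toSet ^ p = volume R.toSet * volume R.toSet ^ (p - 1) := by
    conv_lhs => rw [show p = 1 + (p - 1) by ring]
    rw [ENNReal.rpow_add _ _ (vol_ne_zero R) (vol_ne_top R), ENNReal.rpow_one]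
  have hv0 : volume R.toSet ^ p ≠ 0 := (ENNReal.rpow_pos (pos_iff_ne_zero.2 (vol_ne_zero R)) (vol_ne_top R)).ne'
  have hvt : volume R.toSet ^ p ≠ ⊤ := ENNReal.rpow_ne_top_of_nonneg hp0.le (vol_ne_top R)
  rw [← ENNReal.mul_le_mul_iff_left hv0 hvt, one_mul]
  refine h'.trans_eq ?_
  rw [hv]; ring

lemma youngB {b a V Wt : ℝ≥0∞} {p : ℝ} (hp : 1 < p) (hV : b * Wt = V) :
    b ^ (1 + 1 / (p - 1)) * Wt + ENNReal.ofReal p * (a ^ (1 / (p - 1)) * V) ≤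
      a ^ (1 + 1 / (p - 1)) * Wt + ENNReal.ofReal p * (b ^ (1 / (p - 1)) * V) := by
  have hp0 : 0 < p := by linarith
  have hp1 : 0 < p - 1 := by linarith
  set e := 1 / (p - 1) with he
  have he0 : 0 < e := by positivity
  have hpq : p.HolderConjugate (p / (p - 1)) := Real.HolderConjugate.conjExponent hp
  have hy := ENNReal.young_inequality (a ^ e) b hpq
  have hr : p / (p - 1) = 1 + e := by rw [he]; field_simp; ring
  rw [← ENNReal.rpow_mul, hr, show e * p = 1 + e by rw [he]; field_simp; ring] at hy
  have hbb : b ^ e * V = b ^ (1 + e) * Wt := by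
    rw [← hV, add_comm 1 e, ENNReal.rpow_add_of_nonneg _ _ he0.le zero_le_one, ENNReal.rpow_one]
    ring
  have hpE : ENNReal.ofReal p ≠ 0 := by simpa using hp0
  have hpr : ENNReal.ofReal p = ENNReal.ofReal p / ENNReal.ofReal (1 + e) + 1 := by
    rw [← ENNReal.ofReal_div_of_pos (by positivity), ← ENNReal.ofReal_one,
      ← ENNReal.ofReal_add (by positivity) (by positivity)]
    congr 1
    rw [he]; field_simp; ring
  rw [hbb, ← hV]
  calc b ^ (1 + e) * Wt + ENNReal.ofReal p * (a ^ e * (b * Wt))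
      = b ^ (1 + e) * Wt + ENNReal.ofReal p * (a ^ e * b) * Wt := by ring
    _ ≤ b ^ (1 + e) * Wt + ENNReal.ofReal p * (a ^ (1 + e) / ENNReal.ofReal p +
          b ^ (1 + e) / ENNReal.ofReal (1 + e)) * Wt := by gcongr
    _ = a ^ (1 + e) * Wt * (ENNReal.ofReal p * (ENNReal.ofReal p)⁻¹) +
          (ENNReal.ofReal p / ENNReal.ofReal (1 + e) + 1) * (b ^ (1 + e) * Wt) := by
        simp only [div_eq_mul_inv]; ring
    _ = _ := by
        rw [← hpr, ENNReal.mul_inv_cancel hpE ENNReal.ofReal_ne_top, mul_one]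

lemma youngPt {U W : ℝ≥0∞} (hW0 : W ≠ 0) (hWt : W ≠ ⊤) {p e : ℝ} (hp : 1 < p) (he : 0 < e) :
    U ^ e ≤ (ENNReal.ofReal (2 * p))⁻¹ * (U ^ (1 + e) * W) + ENNReal.ofReal (2 * p) ^ e * W ^ (-e) := by
  have hP0 : ENNReal.ofReal (2 * p) ≠ 0 := by simp; linarith
  rcases le_total (ENNReal.ofReal (2 * p)) (U * W) with h | h
  · refine le_trans ?_ le_self_add
    rw [add_comm 1 e, ENNReal.rpow_add_of_nonneg _ _ he.le zero_le_one, ENNReal.rpow_one]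
    calc U ^ e = U ^ e * ((ENNReal.ofReal (2 * p))⁻¹ * ENNReal.ofReal (2 * p)) := by
          rw [ENNReal.inv_mul_cancel hP0 ENNReal.ofReal_ne_top, mul_one]
      _ ≤ U ^ e * ((ENNReal.ofReal (2 * p))⁻¹ * (U * W)) := by gcongr
      _ = _ := by ring
  · refine le_trans ?_ le_add_self
    have : U ≤ ENNReal.ofReal (2 * p) * W⁻¹ := by
      rw [← div_eq_mul_inv, ENNReal.le_div_iff_mul_le (Or.inl hW0) (Or.inl hWt)]
      exact h
    refine (ENNReal.rpow_le_rpow this he.le).trans_eq ?_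
    rw [ENNReal.mul_rpow_of_nonneg _ _ he.le, ENNReal.inv_rpow, ENNReal.rpow_neg]

lemma mx_rpow_le {a b : ℕ → Rn n → ℝ≥0∞} {x : Rn n} {e : ℝ} {C : ℝ≥0∞} (he : 0 ≤ e) (N : ℕ)
    (h : ∀ k, b k x ≤ C * a k x ^ e) : mx b N x ≤ C * mx a N x ^ e := by
  refine mx_le fun j hj => (h j).trans ?_
  gcongr
  exact (le_mx a j x).trans (mx_mono a x hj)

lemma lemB {W : Rn n → ℝ≥0∞} (hWm : Measurable W) (hW0 : ∀ x, W x ≠ 0) (hWt : ∀ x, W x ≠ ⊤)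
    {p : ℝ} (hp : 1 < p) {e : ℝ} (he : e = 1 / (p - 1)) (P : Cube n)
    (hWi : ∫⁻ x in P.toSet, W x ≠ ⊤)
    (hsi : ∫⁻ x in P.toSet, W x ^ (-e) ≠ ⊤) (N : ℕ) :
    ∫⁻ x in P.toSet, mx (fun k x => (av W P k x)⁻¹) N x ^ e ≤
      2 * (ENNReal.ofReal (2 * p) ^ e * ∫⁻ x in P.toSet, W x ^ (-e)) := by
  have hp0 : 0 < p := by linarith
  have hp1 : 0 < p - 1 := by linarith
  have he0 : 0 < e := by rw [he]; positivity
  set u : ℕ → Rn n → ℝ≥0∞ := fun k x => (av W P k x)⁻¹ with hu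
  set s : Rn n → ℝ≥0∞ := fun x => W x ^ (-e) with hs
  have hum : ∀ k, Measurable (u k) := fun k => (measurable_av W P k).inv
  have hUm : ∀ k, Measurable (mx u k) := measurable_mx hum
  have hucongr : ∀ k x y, y ∈ (cl P k x).toSet → u k y = u k x := by
    intro k x y h
    simp only [hu]
    rw [av_congr W h]
  have hUs : ∀ k x, mx u k x ^ e ≤ mx (av s P) k x := by
    intro k x
    have key : ∀ j, u j x ≤ 1 * (av s P j x) ^ (p - 1) := by
      intro j
      rw [one_mul]
      have h1 := hol hWm hW0 hWt hp (cl P j x)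
      rw [← he] at h1
      rw [hu]
      simp only
      have h1' : 1 ≤ av W P j x * av s P j x ^ (p - 1) := h1
      refine (ENNReal.inv_le_iff_le_mul (fun _ => avg_ne_zero hWm hW0 _) (fun _ h0 => ?_)).2 h1'
      rw [h0] at h1'
      simp at h1'
    have h2 := mx_rpow_le hp1.le k key
    rw [one_mul] at h2
    refine (ENNReal.rpow_le_rpow h2 he0.le).trans_eq ?_
    rw [← ENNReal.rpow_mul, he, mul_one_div_cancel hp1.ne', ENNReal.rpow_one]
  have hYt : ∀ k, ∫⁻ x in P.toSet, mx u k x ^ e ≠ ⊤ := by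
    intro k
    obtain ⟨B, hB, hB'⟩ := exists_bound hsi k
    refine ne_top_of_le_ne_top (b := B * volume P.toSet) ?_ ?_
    · exact ENNReal.mul_ne_top hB (vol_ne_top P)
    · rw [← setLIntegral_const]
      exact setLIntegral_mono measurable_const fun x hx => (hUs k x).trans (hB' x hx)
  set Y := ∫⁻ x in P.toSet, mx u N x ^ e with hY
  have hT := telescope (f := fun k => ∫⁻ x in P.toSet, mx u k x ^ (1 + e) * W x)
    (g := fun k => ENNReal.ofReal p * ∫⁻ x in P.toSet, mx u k x ^ e)
    (fun k => ENNReal.mul_ne_top ENNReal.ofReal_ne_top (hYt k)) N ?_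
  swap
  · intro k hk
    rw [← lintegral_const_mul _ ((hUm _).pow_const _), ← lintegral_const_mul _ ((hUm _).pow_const _),
      ← lintegral_add_right _ (((hUm _).pow_const _).const_mul _),
      ← lintegral_add_right _ (((hUm _).pow_const _).const_mul _)]
    refine lint_le (k + 1) fun x hx => ?_
    set R := (cl P (k + 1) x).toSet with hR
    have hRm : MeasurableSet R := meas_toSet _
    set a := mx u k x with ha
    set b := mx u (k + 1) x with hb
    have e1 : ∀ y ∈ R, mx u k y = a := fun y hy =>
      mx_congr hucongr (cl_subset (Nat.le_succ k) x hy)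
    have e2 : ∀ y ∈ R, mx u (k + 1) y = b := fun y hy => mx_congr hucongr hy
    have L : ∫⁻ y in R, mx u (k + 1) y ^ (1 + e) * W y + ENNReal.ofReal p * mx u k y ^ e
        = b ^ (1 + e) * (∫⁻ y in R, W y) + ENNReal.ofReal p * (a ^ e * volume R) := by
      rw [← mul_assoc, ← setLIntegral_const, ← lintegral_const_mul _ hWm,
        ← lintegral_add_right _ measurable_const]
      refine setLIntegral_congr_fun hRm fun y hy => ?_
      simp only [e1 y hy, e2 y hy]
    have L' : ∫⁻ y in R, mx u k y ^ (1 + e) * W y + ENNReal.ofReal p * mx u (k + 1) y ^ e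
        = a ^ (1 + e) * (∫⁻ y in R, W y) + ENNReal.ofReal p * (b ^ e * volume R) := by
      rw [← mul_assoc, ← setLIntegral_const, ← lintegral_const_mul _ hWm,
        ← lintegral_add_right _ measurable_const]
      refine setLIntegral_congr_fun hRm fun y hy => ?_
      simp only [e1 y hy, e2 y hy]
    rw [L, L']
    rcases le_or_gt (u (k + 1) x) a with h | h
    · have : b = a := max_eq_left h
      rw [this]
    · have hba : b = u (k + 1) x := max_eq_right h.le
      rw [he]
      refine youngB hp ?_
      rw [hba, hu]
      simp only
      rw [← avgE_mul_vol, ← mul_assoc, av, ENNReal.inv_mul_cancel (avg_ne_zero hWm hW0 _), one_mul]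
      refine avg_ne_top (ne_top_of_le_ne_top hWi ?_)
      exact lintegral_mono_set (cl_subset_Q hx _)
  have hf0 : ∫⁻ x in P.toSet, mx u 0 x ^ (1 + e) * W x ≤
      ENNReal.ofReal p * ∫⁻ x in P.toSet, mx u 0 x ^ e := by
    have hu0 : ∀ x ∈ P.toSet, mx u 0 x = (avgE P.toSet W)⁻¹ := by
      intro x hx
      simp [mx, hu, av, cl_zero hx]
    set b := (avgE P.toSet W)⁻¹ with hb
    have E1 : ∫⁻ x in P.toSet, mx u 0 x ^ (1 + e) * W x = b ^ (1 + e) * ∫⁻ x in P.toSet, W x := by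
      rw [← lintegral_const_mul _ hWm]
      refine setLIntegral_congr_fun (meas_toSet P) fun y hy => ?_
      simp only [hu0 y hy]
    have E2 : ∫⁻ x in P.toSet, mx u 0 x ^ e = b ^ e * volume P.toSet := by
      rw [← setLIntegral_const]
      refine setLIntegral_congr_fun (meas_toSet P) fun y hy => ?_
      simp only [hu0 y hy]
    rw [E1, E2, ← avgE_mul_vol, add_comm 1 e, ENNReal.rpow_add_of_nonneg _ _ he0.le zero_le_one,
      ENNReal.rpow_one]
    calc b ^ e * b * (avgE P.toSet W * volume P.toSet)
        = b * avgE P.toSet W * (b ^ e * volume P.toSet) := by ring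
      _ = 1 * (b ^ e * volume P.toSet) := by
          rw [hb, ENNReal.inv_mul_cancel (avg_ne_zero hWm hW0 _) (avg_ne_top hWi)]
      _ ≤ _ := by
          gcongr
          rw [← ENNReal.ofReal_one]
          exact ENNReal.ofReal_le_ofReal hp.le
  have hX : ∫⁻ x in P.toSet, mx u N x ^ (1 + e) * W x ≤ ENNReal.ofReal p * Y := by
    have h0 : ENNReal.ofReal p * ∫⁻ x in P.toSet, mx u 0 x ^ e ≠ ⊤ :=
      ENNReal.mul_ne_top ENNReal.ofReal_ne_top (hYt 0)
    rw [← ENNReal.add_le_add_iff_right h0]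
    refine hT.trans ?_
    rw [add_comm]
    gcongr
  have h3 : Y ≤ 2⁻¹ * Y + ENNReal.ofReal (2 * p) ^ e * ∫⁻ x in P.toSet, s x := by
    calc Y ≤ ∫⁻ x in P.toSet, ((ENNReal.ofReal (2 * p))⁻¹ * (mx u N x ^ (1 + e) * W x) +
            ENNReal.ofReal (2 * p) ^ e * s x) :=
          lintegral_mono fun x => youngPt (hW0 x) (hWt x) hp he0
      _ = (ENNReal.ofReal (2 * p))⁻¹ * (∫⁻ x in P.toSet, mx u N x ^ (1 + e) * W x) +
            ENNReal.ofReal (2 * p) ^ e * ∫⁻ x in P.toSet, s x := by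
          rw [lintegral_add_right _ ((hWm.pow_const _).const_mul _),
            lintegral_const_mul _ (f := fun x => mx u N x ^ (1 + e) * W x)
              (((hUm _).pow_const _).mul hWm),
            lintegral_const_mul _ (hWm.pow_const _)]
      _ ≤ (ENNReal.ofReal (2 * p))⁻¹ * (ENNReal.ofReal p * Y) +
            ENNReal.ofReal (2 * p) ^ e * ∫⁻ x in P.toSet, s x := by gcongr
      _ = _ := by
          congr 1
          rw [← mul_assoc]
          congr 1
          rw [← ENNReal.ofReal_inv_of_pos (by positivity), ← ENNReal.ofReal_mul (by positivity),
            ← ENNReal.ofReal_ofNat 2, ← ENNReal.ofReal_inv_of_pos (by norm_num)]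
          congr 1
          field_simp
  set Z := ENNReal.ofReal (2 * p) ^ e * ∫⁻ x in P.toSet, s x with hZ
  have h4 : 2⁻¹ * Y ≤ Z := by
    have hY2 : Y = 2⁻¹ * Y + 2⁻¹ * Y := by
      rw [← add_mul, ENNReal.inv_two_add_inv_two, one_mul]
    have : 2⁻¹ * Y + 2⁻¹ * Y ≤ 2⁻¹ * Y + Z := by rw [← hY2]; exact h3
    exact (ENNReal.add_le_add_iff_left (ENNReal.mul_ne_top (by simp) (hYt N))).1 this
  calc Y = 2 * (2⁻¹ * Y) := by
          rw [← mul_assoc, ENNReal.mul_inv_cancel (by norm_num) (by norm_num), one_mul]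
      _ ≤ _ := by gcongr

end SparseCZ

namespace SparseCZ
variable {n : ℕ}

lemma avs_le {a b A : ℝ≥0∞} {p e : ℝ} (hp : 1 < p) (he : e = 1 / (p - 1)) (ha0 : a ≠ 0) (hat : a ≠ ⊤)
    (h : a * b ^ (p - 1) ≤ A) : b ≤ A ^ e * a⁻¹ ^ e := by
  have hp1 : 0 < p - 1 := by linarith
  have he0 : 0 < e := by rw [he]; positivity
  have h1 : b ^ (p - 1) ≤ A * a⁻¹ := by
    rw [← div_eq_mul_inv, ENNReal.le_div_iff_mul_le (Or.inl ha0) (Or.inl hat), mul_comm]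
    exact h
  have h2 := ENNReal.rpow_le_rpow h1 he0.le
  rwa [← ENNReal.rpow_mul, he, mul_one_div_cancel hp1.ne', ENNReal.rpow_one, ← he,
    ENNReal.mul_rpow_of_nonneg _ _ he0.le] at h2

lemma dyad {W : Rn n → ℝ≥0∞} (hWm : Measurable W) (hW0 : ∀ x, W x ≠ 0) (hWt : ∀ x, W x ≠ ⊤)
    {p : ℝ} (hp : 1 < p) {e : ℝ} (he : e = 1 / (p - 1))
    (hWi : ∀ R : Cube n, ∫⁻ x in R.toSet, W x ≠ ⊤)
    (hsi : ∀ R : Cube n, ∫⁻ x in R.toSet, W x ^ (-e) ≠ ⊤) {A : ℝ≥0∞}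
    (hA : ∀ R : Cube n, avgE R.toSet W * avgE R.toSet (fun x => W x ^ (-e)) ^ (p - 1) ≤ A)
    (P : Cube n) :
    ∫⁻ x in P.toSet, ⨆ N, mx (av (fun x => W x ^ (-e)) P) N x ≤
      A ^ e * (2 * (ENNReal.ofReal (2 * p) ^ e * ∫⁻ x in P.toSet, W x ^ (-e))) := by
  set s : Rn n → ℝ≥0∞ := fun x => W x ^ (-e) with hs
  have hp1 : 0 < p - 1 := by linarith
  have he0 : 0 < e := by rw [he]; positivity
  rw [lintegral_iSup (measurable_mx (measurable_av s P))
    (fun i j hij x => mx_mono (av s P) x hij)]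
  refine iSup_le fun N => ?_
  refine le_trans ?_ (mul_le_mul_right (lemB hWm hW0 hWt hp he P (hWi P) (hsi P) N) (A ^ e))
  have hum : ∀ k, Measurable (fun x => (av W P k x)⁻¹) := fun k => (measurable_av W P k).inv
  rw [← lintegral_const_mul _ ((measurable_mx hum N).pow_const _)]
  refine lintegral_mono fun x => ?_
  refine mx_rpow_le he0.le N fun k => ?_
  exact avs_le hp he (avg_ne_zero hWm hW0 _) (avg_ne_top (hWi _)) (hA _)

lemma doubling {W : Rn n → ℝ≥0∞} (hWm : Measurable W) (hW0 : ∀ x, W x ≠ 0) (hWt : ∀ x, W x ≠ ⊤)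
    {p : ℝ} (hp : 1 < p) {e : ℝ} (he : e = 1 / (p - 1))
    (hWi : ∀ R : Cube n, ∫⁻ x in R.toSet, W x ≠ ⊤) {A : ℝ≥0∞}
    (hA : ∀ R : Cube n, avgE R.toSet W * avgE R.toSet (fun x => W x ^ (-e)) ^ (p - 1) ≤ A)
    {P Q : Cube n} (hQP : Q.toSet ⊆ P.toSet) {D : ℝ≥0∞}
    (hv : volume P.toSet ≤ D * volume Q.toSet) :
    ∫⁻ x in P.toSet, W x ^ (-e) ≤ (A * D) ^ e * D * ∫⁻ x in Q.toSet, W x ^ (-e) := by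
  set s : Rn n → ℝ≥0∞ := fun x => W x ^ (-e) with hs
  have hp1 : 0 < p - 1 := by linarith
  have he0 : 0 < e := by rw [he]; positivity
  have h1 : avgE Q.toSet W ≤ D * avgE P.toSet W := avgE_le_mul hQP W hv
  have h2 : avgE P.toSet s ≤ (A * D) ^ e * (avgE Q.toSet W)⁻¹ ^ e := by
    refine avs_le hp he (avg_ne_zero hWm hW0 _) (avg_ne_top (hWi _)) ?_
    calc avgE Q.toSet W * avgE P.toSet s ^ (p - 1)
        ≤ D * avgE P.toSet W * avgE P.toSet s ^ (p - 1) := by gcongr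
      _ = (avgE P.toSet W * avgE P.toSet s ^ (p - 1)) * D := by ring
      _ ≤ A * D := by gcongr; exact hA P
  have h3 : (avgE Q.toSet W)⁻¹ ^ e ≤ avgE Q.toSet s := by
    have h := hol hWm hW0 hWt hp Q
    rw [← he] at h
    have h' : 1 ≤ avgE Q.toSet W * avgE Q.toSet s ^ (p - 1) := h
    have h4 : (avgE Q.toSet W)⁻¹ ≤ avgE Q.toSet s ^ (p - 1) := by
      refine (ENNReal.inv_le_iff_le_mul (fun _ => avg_ne_zero hWm hW0 _) (fun _ h0 => ?_)).2 h'
      rw [h0] at h'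
      simp at h'
    refine (ENNReal.rpow_le_rpow h4 he0.le).trans_eq ?_
    rw [← ENNReal.rpow_mul, he, mul_one_div_cancel hp1.ne', ENNReal.rpow_one]
  rw [← avgE_mul_vol, ← avgE_mul_vol]
  calc avgE P.toSet s * volume P.toSet
      ≤ ((A * D) ^ e * avgE Q.toSet s) * (D * volume Q.toSet) := by
        gcongr
        exact h2.trans (by gcongr)
    _ = _ := by ring

lemma third1 {x r t c l h : ℝ} {k : ℕ} (hh : 0 < h) (hl : 3 * l = 2 ^ k * h) (h1 : r ≤ x)
    (h2 : x < r + t) (ht : 3 * t ≤ h) :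
    (c + ⌊(x - c) / h⌋ * h ≤ r ∧ r + t ≤ c + ⌊(x - c) / h⌋ * h + h) ∨
    (c + l + ⌊(x - (c + l)) / h⌋ * h ≤ r ∧ r + t ≤ c + l + ⌊(x - (c + l)) / h⌋ * h + h) := by
  have key : ∀ d : ℝ, ¬ (d + ⌊(x - d) / h⌋ * h ≤ r ∧ r + t ≤ d + ⌊(x - d) / h⌋ * h + h) →
      ∃ j : ℤ, r < d + j * h ∧ d + j * h < r + t := by
    intro d hd
    have f1 := Int.floor_le ((x - d) / h)
    have f2 := Int.lt_floor_add_one ((x - d) / h)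
    rw [le_div_iff₀ hh] at f1
    rw [div_lt_iff₀ hh] at f2
    by_cases hc : d + ⌊(x - d) / h⌋ * h ≤ r
    · have hc' : ¬ (r + t ≤ d + ⌊(x - d) / h⌋ * h + h) := fun h' => hd ⟨hc, h'⟩
      refine ⟨⌊(x - d) / h⌋ + 1, ?_, ?_⟩ <;> push_cast <;> linarith
    · exact ⟨⌊(x - d) / h⌋, by linarith, by linarith⟩
  by_contra hcon
  rw [not_or] at hcon
  obtain ⟨j, j1, j2⟩ := key c hcon.1
  obtain ⟨i, i1, i2⟩ := key (c + l) hcon.2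
  have g1 : (3 * (j - i) - 2 ^ k : ℝ) * h < 1 * h := by linarith
  have g2 : (-1 : ℝ) * h < (3 * (j - i) - 2 ^ k : ℝ) * h := by linarith
  have g1' := lt_of_mul_lt_mul_right g1 hh.le
  have g2' := lt_of_mul_lt_mul_right g2 hh.le
  have k1 : 3 * (j - i) - 2 ^ k < (1 : ℤ) := by exact_mod_cast g1'
  have k2 : (-1 : ℤ) < 3 * (j - i) - 2 ^ k := by exact_mod_cast g2'
  have k3 : (2 : ℤ) ^ k = 3 * (j - i) := by omega
  have k4 : (3 : ℤ) ∣ 2 ^ k := ⟨_, k3⟩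
  have k5 := Int.prime_three.dvd_of_dvd_pow k4
  norm_num at k5

/-- shifted top cubes -/
def top3 (Q : Cube n) (α : Fin n → Bool) : Cube n :=
  ⟨fun i => Q.corner i - Q.side + (if α i then Q.side else 0), 3 * Q.side, by
    have := Q.side_pos; positivity⟩

lemma subset_top3 (Q : Cube n) (α : Fin n → Bool) : Q.toSet ⊆ (top3 Q α).toSet := by
  intro x hx i
  have h := hx i
  have := Q.side_pos
  simp only [top3]
  split_ifs <;> constructor <;> linarith [h.1, h.2]

lemma vol_top3 (Q : Cube n) (α : Fin n → Bool) :
    volume (top3 Q α).toSet = 3 ^ n * volume Q.toSet := by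
  rw [vol_toSet, vol_toSet, ← mul_pow, ← ENNReal.ofReal_ofNat 3, ← ENNReal.ofReal_mul (by norm_num)]
  rfl

lemma thirds {Q R : Cube n} {x : Rn n} (hxR : x ∈ R.toSet) {k : ℕ}
    (hR : R.side ≤ Q.side / 2 ^ k) : ∃ α, R.toSet ⊆ (cl (top3 Q α) k x).toSet := by
  classical
  have hQ := Q.side_pos
  set h : ℝ := 3 * Q.side / 2 ^ k with hh
  have hpos : 0 < h := by positivity
  have H : ∀ i : Fin n, ∃ b : Bool,
      (Q.corner i - Q.side + (if b then Q.side else 0)) +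
        ⌊(x i - (Q.corner i - Q.side + (if b then Q.side else 0))) / h⌋ * h ≤ R.corner i ∧
      R.corner i + R.side ≤ (Q.corner i - Q.side + (if b then Q.side else 0)) +
        ⌊(x i - (Q.corner i - Q.side + (if b then Q.side else 0))) / h⌋ * h + h := by
    intro i
    have := third1 (x := x i) (r := R.corner i) (t := R.side) (c := Q.corner i - Q.side)
      (l := Q.side) (h := h) (k := k) hpos (by rw [hh]; field_simp) (hxR i).1 (hxR i).2
      (by rw [hh, mul_div_assoc]; linarith)
    rcases this with h1 | h1
    · exact ⟨false, by simpa using h1⟩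
    · exact ⟨true, by simpa using h1⟩
  choose α hα using H
  refine ⟨α, fun y hy i => ?_⟩
  have h1 := hα i
  have h2 := hy i
  simp only [cl, cell, idx, top3]
  exact ⟨h1.1.trans h2.1, h2.2.trans_le h1.2⟩

lemma hlMax_le (s : Rn n → ℝ≥0∞) {Q : Cube n} {x : Rn n} (hx : x ∈ Q.toSet) :
    hlMax (Q.toSet.indicator s) x ≤
      6 ^ n * ∑ α : Fin n → Bool, ⨆ N, mx (av s (top3 Q α)) N x := by
  have hQ := Q.side_pos
  have hsingle : ∀ (α : Fin n → Bool) (k : ℕ), av s (top3 Q α) k x ≤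
      ∑ α : Fin n → Bool, ⨆ N, mx (av s (top3 Q α)) N x := by
    intro α k
    refine le_trans ((le_mx _ _ _).trans (le_iSup (fun N => mx (av s (top3 Q α)) N x) k)) ?_
    exact Finset.single_le_sum (f := fun α => ⨆ N, mx (av s (top3 Q α)) N x)
      (fun _ _ => zero_le) (Finset.mem_univ α)
  refine iSup₂_le fun R hxR => ?_
  rcases le_or_gt R.side Q.side with h | h
  · obtain ⟨k, hk1, hk2⟩ := exists_nat_pow_near (x := Q.side / R.side) (y := (2 : ℝ))
      ((one_le_div R.side_pos).2 h) (by norm_num)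
    have hRpos := R.side_pos
    rw [le_div_iff₀ hRpos] at hk1
    rw [div_lt_iff₀ hRpos] at hk2
    have hk3 : R.side ≤ Q.side / 2 ^ k := by
      rw [le_div_iff₀ (by positivity)]; linarith
    obtain ⟨α, hα⟩ := thirds hxR hk3
    have hvol : volume (cl (top3 Q α) k x).toSet ≤ 6 ^ n * volume R.toSet := by
      rw [vol_cl, vol_toSet, ← mul_pow, ← ENNReal.ofReal_ofNat 6, ← ENNReal.ofReal_mul (by norm_num)]
      refine pow_le_pow_left' (ENNReal.ofReal_le_ofReal ?_) n
      simp only [top3]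
      rw [div_le_iff₀ (by positivity)]
      rw [pow_succ] at hk2
      linarith
    calc avgE R.toSet (Q.toSet.indicator s) ≤ avgE R.toSet s := by
          unfold avgE
          gcongr
          exact indicator_le_self _ _ _
      _ ≤ 6 ^ n * av s (top3 Q α) k x := avgE_le_mul hα s hvol
      _ ≤ _ := by gcongr; exact hsingle α k
  · have h0 : avgE R.toSet (Q.toSet.indicator s) ≤ avgE Q.toSet s := by
      unfold avgE
      refine mul_le_mul' ?_ ?_
      · rw [ENNReal.inv_le_inv, vol_toSet, vol_toSet]
        exact pow_le_pow_left' (ENNReal.ofReal_le_ofReal h.le) n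
      · refine (setLIntegral_le_lintegral _ _).trans ?_
        rw [lintegral_indicator (meas_toSet Q)]
    have h1 : avgE Q.toSet s ≤ 3 ^ n * avgE (top3 Q fun _ => false).toSet s :=
      avgE_le_mul (subset_top3 _ _) s (vol_top3 _ _).le
    have h2 := hsingle (fun _ => false) 0
    rw [av, cl_zero (subset_top3 _ _ hx)] at h2
    refine h0.trans (h1.trans ?_)
    gcongr
    norm_num

lemma ainfty_bound {W : Rn n → ℝ≥0∞} (hWm : Measurable W) (hW0 : ∀ x, W x ≠ 0)
    (hWt : ∀ x, W x ≠ ⊤)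
    {p : ℝ} (hp : 1 < p) {e : ℝ} (he : e = 1 / (p - 1))
    (hWi : ∀ R : Cube n, ∫⁻ x in R.toSet, W x ≠ ⊤)
    (hsi : ∀ R : Cube n, ∫⁻ x in R.toSet, W x ^ (-e) ≠ ⊤) {A : ℝ≥0∞} (hAt : A ≠ ⊤)
    (hA : ∀ R : Cube n, avgE R.toSet W * avgE R.toSet (fun x => W x ^ (-e)) ^ (p - 1) ≤ A) :
    ∃ C : ℝ≥0∞, C ≠ ⊤ ∧ ∀ Q : Cube n,
      ∫⁻ x in Q.toSet, hlMax (Q.toSet.indicator fun x => W x ^ (-e)) x ≤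
        C * ∫⁻ x in Q.toSet, W x ^ (-e) := by
  set s : Rn n → ℝ≥0∞ := fun x => W x ^ (-e) with hs
  have hp1 : 0 < p - 1 := by linarith
  have he0 : 0 < e := by rw [he]; positivity
  set C1 := A ^ e * (2 * (ENNReal.ofReal (2 * p) ^ e * ((A * 3 ^ n) ^ e * 3 ^ n))) with hC1
  have hC1t : C1 ≠ ⊤ := by
    have h1 : A ^ e ≠ ⊤ := ENNReal.rpow_ne_top_of_nonneg he0.le hAt
    have h2 : ENNReal.ofReal (2 * p) ^ e ≠ ⊤ :=
      ENNReal.rpow_ne_top_of_nonneg he0.le ENNReal.ofReal_ne_top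
    have h3 : (A * 3 ^ n) ^ e ≠ ⊤ :=
      ENNReal.rpow_ne_top_of_nonneg he0.le (ENNReal.mul_ne_top hAt (by finiteness))
    rw [hC1]
    finiteness
  refine ⟨6 ^ n * ∑ _α : Fin n → Bool, C1, ?_, fun Q => ?_⟩
  · simp only [Finset.sum_const, nsmul_eq_mul]
    finiteness
  have hmeas : ∀ P : Cube n, Measurable fun x => ⨆ N, mx (av s P) N x :=
    fun P => Measurable.iSup (measurable_mx (measurable_av s P))
  calc ∫⁻ x in Q.toSet, hlMax (Q.toSet.indicator s) x
      ≤ ∫⁻ x in Q.toSet, 6 ^ n * ∑ α : Fin n → Bool, ⨆ N, mx (av s (top3 Q α)) N x :=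
        setLIntegral_mono' (meas_toSet Q) fun x hx => hlMax_le s hx
    _ = 6 ^ n * ∑ α : Fin n → Bool, ∫⁻ x in Q.toSet, ⨆ N, mx (av s (top3 Q α)) N x := by
        rw [lintegral_const_mul _ (Finset.measurable_fun_sum _ fun α _ => hmeas _),
          lintegral_finsetSum _ fun α _ => hmeas _]
    _ ≤ 6 ^ n * ∑ α : Fin n → Bool, C1 * ∫⁻ x in Q.toSet, s x := by
        gcongr with α
        refine (lintegral_mono_set (subset_top3 Q α)).trans ?_
        refine (dyad hWm hW0 hWt hp he hWi hsi hA (top3 Q α)).trans ?_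
        have hd := doubling hWm hW0 hWt hp he hWi hA (subset_top3 Q α) (vol_top3 Q α).le
        calc _ ≤ A ^ e * (2 * (ENNReal.ofReal (2 * p) ^ e *
              ((A * 3 ^ n) ^ e * 3 ^ n * ∫⁻ x in Q.toSet, s x))) := by gcongr
          _ = _ := by rw [hC1]; ring
    _ = _ := by rw [← Finset.sum_mul, mul_assoc]

end SparseCZ

namespace SparseCZ
variable {n : ℕ}

lemma int_w_ne_top {w : Rn n → ℝ} (hw : LocallyIntegrable w volume) (R : Cube n) :
    ∫⁻ x in R.toSet, ENNReal.ofReal (w x) ≠ ⊤ := by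
  have hK : IsCompact ((EuclideanSpace.equiv (Fin n) ℝ).symm ''
      (Set.Icc R.corner (fun i => R.corner i + R.side))) :=
    isCompact_Icc.image (EuclideanSpace.equiv (Fin n) ℝ).symm.continuous
  have hsub : R.toSet ⊆ (EuclideanSpace.equiv (Fin n) ℝ).symm ''
      (Set.Icc R.corner (fun i => R.corner i + R.side)) := by
    intro x hx
    refine ⟨EuclideanSpace.equiv (Fin n) ℝ x, ⟨fun i => (hx i).1, fun i => (hx i).2.le⟩, ?_⟩
    simp
  have hi : IntegrableOn w R.toSet volume := (hw.integrableOn_isCompact hK).mono_set hsub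
  exact (hi.lintegral_lt_top).ne

lemma avgE_indicator (s : Rn n → ℝ≥0∞) {P R : Cube n} (h : P.toSet ⊆ R.toSet) :
    avgE P.toSet (R.toSet.indicator s) = avgE P.toSet s := by
  rw [avgE, avgE]
  congr 1
  refine setLIntegral_congr_fun (meas_toSet P) fun x hx => ?_
  exact Set.indicator_of_mem (h hx) s

lemma avgE_le_hlMax (s : Rn n → ℝ≥0∞) {P R : Cube n} (h : P.toSet ⊆ R.toSet) {y : Rn n}
    (hy : y ∈ P.toSet) : avgE P.toSet s ≤ hlMax (R.toSet.indicator s) y := by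
  rw [← avgE_indicator s h]
  exact le_iSup₂ (f := fun (Q : Cube n) (_ : y ∈ Q.toSet) => avgE Q.toSet (R.toSet.indicator s)) P hy

lemma mx_le_hlMax (s : Rn n → ℝ≥0∞) {Q : Cube n} {N k : ℕ} {x y : Rn n}
    (hx : mx (av s Q) k x = av s Q k x) (hy : y ∈ (cl Q k x).toSet) :
    mx (av s Q) N y ≤ hlMax ((cl Q k x).toSet.indicator s) y := by
  refine mx_le fun j _ => ?_
  rcases le_total j k with h | h
  · have h1 : av s Q j y = av s Q j x := av_congr s (cl_subset h x hy)
    rw [h1]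
    calc av s Q j x ≤ mx (av s Q) j x := le_mx _ _ _
      _ ≤ mx (av s Q) k x := mx_mono _ x h
      _ = avgE (cl Q k x).toSet s := hx
      _ ≤ _ := avgE_le_hlMax s subset_rfl hy
  · refine avgE_le_hlMax s ?_ (mem_cl Q j y)
    rw [← cl_eq_of_mem hy]
    exact cl_subset h y

theorem main_bound (p : ℝ) (hp : 1 < p) (w : Rn n → ℝ) (hw : IsWeight w)
    (hAp : ApConst n p w ≠ ⊤) (ε : ℝ)
    (hε : ε = (p - 1) /
      (1 + 2 ^ (n + 1) * (AinftyConst n fun x => w x ^ (1 - p / (p - 1))).toReal)) :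
    ApConst n (p - ε) w ≤ (2 : ℝ≥0∞) ^ (p - 1) * ApConst n p w := by
  obtain ⟨hwm, hwpos, hwl⟩ := hw
  have hp1 : 0 < p - 1 := by linarith
  set W : Rn n → ℝ≥0∞ := fun x => ENNReal.ofReal (w x) with hW
  have hWm : Measurable W := hwm.ennreal_ofReal
  have hW0 : ∀ x, W x ≠ 0 := fun x => (ENNReal.ofReal_pos.2 (hwpos x)).ne'
  have hWt : ∀ x, W x ≠ ⊤ := fun x => ENNReal.ofReal_ne_top
  have hWi : ∀ R : Cube n, ∫⁻ x in R.toSet, W x ≠ ⊤ := int_w_ne_top hwl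
  obtain ⟨e, he⟩ : ∃ e : ℝ, e = 1 / (p - 1) := ⟨_, rfl⟩
  have he0 : 0 < e := by rw [he]; positivity
  have hexp : 1 - p / (p - 1) = -e := by rw [he]; field_simp; ring
  set s : Rn n → ℝ≥0∞ := fun x => W x ^ (-e) with hs
  have hpow : ∀ (r : ℝ) x, ENNReal.ofReal (w x ^ r) = W x ^ r := fun r x =>
    (ENNReal.ofReal_rpow_of_pos (hwpos x)).symm
  have hsm : Measurable s := hWm.pow_const _
  have hs0 : ∀ x, s x ≠ 0 := fun x => (ENNReal.rpow_pos (pos_iff_ne_zero.2 (hW0 x)) (hWt x)).ne'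
  have hA : ∀ R : Cube n, avgE R.toSet W * avgE R.toSet s ^ (p - 1) ≤ ApConst n p w := by
    intro R
    have := le_iSup (fun Q : Cube n => avgE Q.toSet (fun x => ENNReal.ofReal (w x)) *
      (avgE Q.toSet fun x => ENNReal.ofReal (w x ^ (1 - p / (p - 1)))) ^ (p - 1)) R
    simp only [hpow, hexp] at this
    rw [ApConst]
    simp only [hpow, hexp]
    exact this
  have hsi : ∀ R : Cube n, ∫⁻ x in R.toSet, s x ≠ ⊤ := by
    intro R
    apply int_ne_top
    intro h
    have h1 := hA R
    rw [h, ENNReal.top_rpow_of_pos hp1, ENNReal.mul_top (avg_ne_zero hWm hW0 R)] at h1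
    exact hAp (top_le_iff.1 h1)
  have hAinf : AinftyConst n (fun x => w x ^ (1 - p / (p - 1))) = ⨆ Q : Cube n,
      (∫⁻ x in Q.toSet, s x)⁻¹ * ∫⁻ x in Q.toSet, hlMax (Q.toSet.indicator s) x := by
    rw [AinftyConst]
    refine iSup_congr fun Q => ?_
    have h1 : (fun y => ENNReal.ofReal (Q.toSet.indicator (fun x => w x ^ (1 - p / (p - 1))) y))
        = Q.toSet.indicator s := by
      funext y
      by_cases hy : y ∈ Q.toSet
      · simp only [Set.indicator_of_mem hy, hexp, hpow, hs]
      · simp [Set.indicator_of_notMem hy]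
    rw [h1, wInt]
    simp only [hpow, hexp, hs]
  obtain ⟨C, hCt, hC⟩ := ainfty_bound hWm hW0 hWt hp he hWi hsi hAp hA
  rw [hAinf] at hε
  set B : ℝ≥0∞ := ⨆ Q : Cube n,
      (∫⁻ x in Q.toSet, s x)⁻¹ * ∫⁻ x in Q.toSet, hlMax (Q.toSet.indicator s) x with hB
  have hBt : B ≠ ⊤ := by
    refine ne_top_of_le_ne_top hCt (iSup_le fun Q => ?_)
    have h0 := int_ne_zero hsm hs0 Q
    calc _ ≤ (∫⁻ x in Q.toSet, s x)⁻¹ * (C * ∫⁻ x in Q.toSet, s x) := by gcongr; exact hC Q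
      _ = C * ((∫⁻ x in Q.toSet, s x)⁻¹ * (∫⁻ x in Q.toSet, s x)) := by ring
      _ = C := by rw [ENNReal.inv_mul_cancel h0 (hsi Q), mul_one]
  have hBQ : ∀ Q : Cube n, ∫⁻ x in Q.toSet, hlMax (Q.toSet.indicator s) x ≤
      B * ∫⁻ x in Q.toSet, s x := by
    intro Q
    have h0 := int_ne_zero hsm hs0 Q
    have h1 : (∫⁻ x in Q.toSet, s x)⁻¹ * ∫⁻ x in Q.toSet, hlMax (Q.toSet.indicator s) x ≤ B :=
      le_iSup (fun Q : Cube n => (∫⁻ x in Q.toSet, s x)⁻¹ *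
        ∫⁻ x in Q.toSet, hlMax (Q.toSet.indicator s) x) Q
    calc _ = ((∫⁻ x in Q.toSet, s x)⁻¹ * ∫⁻ x in Q.toSet, hlMax (Q.toSet.indicator s) x) *
          ∫⁻ x in Q.toSet, s x := by
          rw [mul_comm (_)⁻¹, mul_assoc, ENNReal.inv_mul_cancel h0 (hsi Q), mul_one]
      _ ≤ _ := by gcongr
  have hB1 : 1 ≤ B := by
    set Q : Cube n := ⟨0, 1, one_pos⟩
    have h0 := int_ne_zero hsm hs0 Q
    have h1 := hBQ Q
    have h2 : ∫⁻ x in Q.toSet, s x ≤ ∫⁻ x in Q.toSet, hlMax (Q.toSet.indicator s) x := by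
      calc ∫⁻ x in Q.toSet, s x = ∫⁻ x in Q.toSet, avgE Q.toSet s := by
            rw [setLIntegral_const, avgE_mul_vol]
        _ ≤ _ := setLIntegral_mono' (meas_toSet Q) fun x hx => avgE_le_hlMax s subset_rfl hx
    have h3 : 1 * ∫⁻ x in Q.toSet, s x ≤ B * ∫⁻ x in Q.toSet, s x := by
      rw [one_mul]; exact h2.trans h1
    exact (ENNReal.mul_le_mul_iff_left h0 (hsi Q)).1 h3
  have hK1 : 0 < B.toReal := ENNReal.toReal_pos (zero_lt_one.trans_le hB1).ne' hBt
  have hKB : ENNReal.ofReal B.toReal = B := ENNReal.ofReal_toReal hBt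
  obtain ⟨δ, hδ⟩ : ∃ δ : ℝ, δ = 1 / (2 ^ (n + 1) * B.toReal) := ⟨_, rfl⟩
  have hRH : ∀ Q : Cube n, avgE Q.toSet (fun x => s x ^ (1 + δ)) ≤ 2 * avgE Q.toSet s ^ (1 + δ) := by
    intro Q
    refine RH hsm (hsi Q) hK1 (fun N k _ x _ hm => ?_) hδ
    rw [hKB]
    refine le_trans ?_ (hBQ (cl Q k x))
    exact setLIntegral_mono' (meas_toSet _) fun y hy => mx_le_hlMax s hm hy
  obtain ⟨T, hT⟩ : ∃ T : ℝ, T = 2 ^ (n + 1) * B.toReal := ⟨_, rfl⟩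
  have hT0 : 0 < T := by rw [hT]; positivity
  rw [← hT] at hε hδ
  have hq : p - ε - 1 = (p - 1) * T / (1 + T) := by rw [hε]; field_simp; ring
  have hq0 : 0 < p - ε - 1 := by rw [hq]; positivity
  have hqle : p - ε - 1 ≤ p - 1 := by
    have : 0 < ε := by rw [hε]; positivity
    linarith
  have hm1 : (1 + δ) * (p - ε - 1) = p - 1 := by rw [hq, hδ]; field_simp; ring
  have hm2 : 1 - (p - ε) / (p - ε - 1) = -e * (1 + δ) := by
    have h1 : 1 - (p - ε) / (p - ε - 1) = -(1 / (p - ε - 1)) := by field_simp; ring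
    have h2 : 1 / (p - ε - 1) = e * (1 + δ) := by
      rw [he, div_eq_iff hq0.ne', mul_assoc, hm1]; field_simp
    rw [h1, h2]; ring
  rw [ApConst]
  refine iSup_le fun Q => ?_
  have hfun : (fun x => ENNReal.ofReal (w x ^ (1 - (p - ε) / (p - ε - 1)))) =
      fun x => s x ^ (1 + δ) := by
    funext x
    rw [hpow, hm2, ENNReal.rpow_mul]
  rw [hfun]
  calc avgE Q.toSet W * avgE Q.toSet (fun x => s x ^ (1 + δ)) ^ (p - ε - 1)
      ≤ avgE Q.toSet W * (2 * avgE Q.toSet s ^ (1 + δ)) ^ (p - ε - 1) := by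
        gcongr; exact hRH Q
    _ = 2 ^ (p - ε - 1) * (avgE Q.toSet W * avgE Q.toSet s ^ (p - 1)) := by
        rw [ENNReal.mul_rpow_of_nonneg _ _ hq0.le, ← ENNReal.rpow_mul, hm1]; ring
    _ ≤ 2 ^ (p - 1) * ApConst n p w := by
        gcongr
        · exact one_le_two
        · exact hA Q

end SparseCZ

open SparseCZ in
/-- sharp open property of `A_p` (Pérez): `w ∈ A_{p-ε}` with
`ε = (p-1)/(1 + 2^{n+1}[σ]_{A_∞})`, `σ = w^{1-p'}`, and `[w]_{A_{p-ε}} ≤ 2^{p-1}[w]_{A_p}`. -/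
theorem stmt4 (n : ℕ) (p : ℝ) (hp : 1 < p) (w : Rn n → ℝ) (hw : IsWeight w)
    (hAp : ApConst n p w ≠ ⊤) (ε : ℝ)
    (hε : ε = (p - 1) /
      (1 + 2 ^ (n + 1) * (AinftyConst n fun x => w x ^ (1 - p / (p - 1))).toReal)) :
    ApConst n (p - ε) w ≠ ⊤ ∧ ApConst n (p - ε) w ≤ (2 : ℝ≥0∞) ^ (p - 1) * ApConst n p w := by
  have h := main_bound p hp w hw hAp ε hε
  exact ⟨ne_top_of_le_ne_top (ENNReal.mul_ne_top
    (ENNReal.rpow_ne_top_of_nonneg (by linarith) ENNReal.ofNat_ne_top) hAp) h, h⟩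
end
end

section
/- Let w∈A_∞, let D be a dyadic grid in ℝⁿ, and let φ∈Φ be such that φ^α is quasi-convex for some 0<α<1. Then there exists a constant a₂>1, depending only on φ and α (in particular independent of w), such that ∫_{ℝⁿ} φ(M^D_w f(x))·w(x)dx ≤ a₂·∫_{ℝⁿ} φ(a₂·|f(x)|)·w(x)dx for all f. -/
open MeasureTheory Set Filter
open scoped ENNReal NNReal Topology

noncomputable section

namespace SparseCZ

/-- Weak-type bound for a finite laminar family. -/
theorem finite_laminar {X : Type*} [MeasurableSpace X] (μ : Measure X) (S : Finset (Set X))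
    (hm : ∀ s ∈ S, MeasurableSet s)
    (hl : ∀ s ∈ S, ∀ t ∈ S, s ∩ t = s ∨ s ∩ t = t ∨ s ∩ t = ∅)
    (g : X → ℝ≥0∞) (l : ℝ≥0∞) (h : ∀ s ∈ S, l * μ s ≤ ∫⁻ x in s, g x ∂μ) :
    l * μ (⋃ s ∈ S, s) ≤ ∫⁻ x, g x ∂μ := by
  classical
  let T := S.filter (fun s => Maximal (fun x => x ∈ S) s)
  have hU : (⋃ s ∈ S, s) = ⋃ s ∈ T, s := by
    apply Set.Subset.antisymm
    · intro x hx
      simp only [Set.mem_iUnion, exists_prop] at hx ⊢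
      obtain ⟨s, hs, hxs⟩ := hx
      obtain ⟨b, hb, hbm⟩ := Finset.exists_le_maximal S hs
      exact ⟨b, Finset.mem_filter.2 ⟨hbm.1, hbm⟩, hb hxs⟩
    · intro x hx
      simp only [Set.mem_iUnion, exists_prop] at hx ⊢
      obtain ⟨s, hs, hxs⟩ := hx
      exact ⟨s, (Finset.mem_filter.1 hs).1, hxs⟩
  have hd : Set.PairwiseDisjoint (T : Set (Set X)) (fun s => s) := by
    intro s hs t ht hst
    have hs' := Finset.mem_filter.1 (Finset.mem_coe.1 hs)
    have ht' := Finset.mem_filter.1 (Finset.mem_coe.1 ht)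
    rcases hl s hs'.1 t ht'.1 with h1 | h1 | h1
    · exact absurd (hs'.2.eq_of_le ht'.1 (Set.inter_eq_left.1 h1)) hst
    · exact absurd (ht'.2.eq_of_le hs'.1 (Set.inter_eq_right.1 h1)).symm hst
    · exact Set.disjoint_iff_inter_eq_empty.2 h1
  have hmT : ∀ s ∈ T, MeasurableSet s := fun s hs => hm s (Finset.mem_filter.1 hs).1
  calc l * μ (⋃ s ∈ S, s) = ∑ s ∈ T, l * μ s := by
        rw [hU, measure_biUnion_finset hd hmT, Finset.mul_sum]
    _ ≤ ∑ s ∈ T, ∫⁻ x in s, g x ∂μ :=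
        Finset.sum_le_sum fun s hs => h s (Finset.mem_filter.1 hs).1
    _ = ∫⁻ x in ⋃ s ∈ T, s, g x ∂μ := (lintegral_biUnion_finset hd hmT g).symm
    _ ≤ ∫⁻ x, g x ∂μ := setLIntegral_le_lintegral _ _

theorem seq_laminar {X : Type*} [MeasurableSpace X] (μ : Measure X) (s : ℕ → Set X)
    (hm : ∀ i, MeasurableSet (s i))
    (hl : ∀ i j, s i ∩ s j = s i ∨ s i ∩ s j = s j ∨ s i ∩ s j = ∅)
    (g : X → ℝ≥0∞) (l : ℝ≥0∞) (h : ∀ i, l * μ (s i) ≤ ∫⁻ x in s i, g x ∂μ) :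
    l * μ (⋃ i, s i) ≤ ∫⁻ x, g x ∂μ := by
  classical
  rw [measure_iUnion_eq_iSup_accumulate, ENNReal.mul_iSup]
  refine iSup_le fun N => ?_
  have := finite_laminar μ ((Finset.range (N + 1)).image s) ?_ ?_ g l ?_
  · have hacc : Set.accumulate s N = ⋃ t ∈ (Finset.range (N + 1)).image s, t := by
      ext x
      simp [Set.mem_accumulate]
    rw [hacc]
    exact this
  · intro t ht
    obtain ⟨i, -, rfl⟩ := Finset.mem_image.1 ht
    exact hm i
  · intro t ht u hu
    obtain ⟨i, -, rfl⟩ := Finset.mem_image.1 ht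
    obtain ⟨j, -, rfl⟩ := Finset.mem_image.1 hu
    exact hl i j
  · intro t ht
    obtain ⟨i, -, rfl⟩ := Finset.mem_image.1 ht
    exact h i

theorem Cube.measurableSet {n : ℕ} (Q : Cube n) : MeasurableSet Q.toSet := by
  have : Q.toSet = ⋂ i, {x : Rn n | Q.corner i ≤ x i ∧ x i < Q.corner i + Q.side} := by
    ext x; simp [Cube.toSet]
  rw [this]
  refine MeasurableSet.iInter fun i => ?_
  have hmi : Measurable fun x : Rn n => x i := by fun_prop
  exact (measurableSet_le measurable_const hmi).inter (measurableSet_lt hmi measurable_const)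

theorem Cube.wInt_lt_top {n : ℕ} (Q : Cube n) {w : Rn n → ℝ} (hw : IsWeight w) :
    wInt w Q.toSet < ⊤ := by
  let K : Set (Rn n) := (WithLp.toLp 2) '' Set.Icc Q.corner (fun i => Q.corner i + Q.side)
  have hK : IsCompact K := isCompact_Icc.image (PiLp.continuous_toLp 2 _)
  have hsub : Q.toSet ⊆ K := by
    intro x hx
    refine ⟨WithLp.ofLp x, ⟨fun i => (hx i).1, fun i => (hx i).2.le⟩, rfl⟩
  have hi : IntegrableOn w Q.toSet := (hw.2.2.integrableOn_isCompact hK).mono_set hsub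
  have := hi.hasFiniteIntegral
  rw [hasFiniteIntegral_iff_ofReal (Eventually.of_forall fun x => (hw.2.1 x).le)] at this
  exact this

theorem grid_seq {n : ℕ} {D : Set (Cube n)} (hD : IsDyadicGrid D) :
    ∃ e : ℕ → Cube n, (∀ i, e i ∈ D) ∧ ∀ Q ∈ D, ∃ i, e i = Q := by
  have hc : D.Countable := by
    choose c hc hu using hD.2.2
    have : D ⊆ Set.range fun p : ℤ × ℕ => c p.1 (TopologicalSpace.denseSeq (Rn n) p.2) := by
      intro Q hQ
      obtain ⟨k, hk⟩ := hD.1 Q hQ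
      let U : Set (Rn n) := ⋂ i, {x : Rn n | Q.corner i < x i ∧ x i < Q.corner i + Q.side}
      have hU : IsOpen U := by
        refine isOpen_iInter_of_finite fun i => ?_
        have hmi : Continuous fun x : Rn n => x i := by fun_prop
        exact (isOpen_lt continuous_const hmi).inter (isOpen_lt hmi continuous_const)
      have hne : U.Nonempty := by
        refine ⟨WithLp.toLp 2 (fun i => Q.corner i + Q.side / 2), ?_⟩
        have := Q.side_pos
        simp only [U, Set.mem_iInter, Set.mem_ofPred_eq]
        intro i
        constructor <;> linarith
      obtain ⟨x, hx, m, rfl⟩ := (TopologicalSpace.denseRange_denseSeq (Rn n)).exists_mem_open hU hne |>.elim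
        fun m hm => (⟨_, hm, m, rfl⟩ : ∃ x ∈ U, ∃ m, TopologicalSpace.denseSeq (Rn n) m = x)
      refine ⟨(k, m), ?_⟩
      refine (hu k _ Q ⟨hQ, hk, ?_⟩).symm
      intro i
      have := Set.mem_iInter.1 hx i
      exact ⟨this.1.le, this.2⟩
    exact (Set.countable_range _).mono this
  have hne : D.Nonempty := by
    obtain ⟨Q, hQ, -⟩ := hD.2.2 0 0
    exact ⟨Q, hQ.1⟩
  obtain ⟨e, he⟩ := hc.exists_eq_range hne
  refine ⟨e, fun i => he ▸ Set.mem_range_self i, fun Q hQ => ?_⟩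
  rw [he] at hQ
  exact hQ

theorem wMeasure_lintegral {n : ℕ} {w : Rn n → ℝ} (hw : IsWeight w) (s : Set (Rn n))
    (hs : MeasurableSet s) (g : Rn n → ℝ≥0∞) :
    ∫⁻ x in s, g x ∂(wMeasure w) = ∫⁻ x in s, g x * ENNReal.ofReal (w x) := by
  rw [wMeasure, restrict_withDensity hs,
    lintegral_withDensity_eq_lintegral_mul_non_measurable _ hw.1.ennreal_ofReal
      (Eventually.of_forall fun x => ENNReal.ofReal_lt_top)]
  simp [mul_comm]

/-- Weak type inequality with truncation, plus measurability of the level set. -/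
theorem weak_type {n : ℕ} {w : Rn n → ℝ} (hw : IsWeight w) {D : Set (Cube n)}
    (hD : IsDyadicGrid D) (g : Rn n → ℝ≥0∞) (l : ℝ≥0∞) (hl : l ≠ ⊤) :
    MeasurableSet {x | 2 * l < dyadicMaxW D w g x} ∧
    l * wMeasure w {x | 2 * l < dyadicMaxW D w g x} ≤
      ∫⁻ x, {x | l < g x}.indicator g x ∂(wMeasure w) := by
  classical
  obtain ⟨e, heD, he⟩ := grid_seq hD
  let A : Cube n → ℝ≥0∞ := fun Q =>
    (wInt w Q.toSet)⁻¹ * ∫⁻ y in Q.toSet, g y * ENNReal.ofReal (w y)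
  let s : ℕ → Set (Rn n) := fun i => if 2 * l < A (e i) then (e i).toSet else ∅
  have hE : {x | 2 * l < dyadicMaxW D w g x} = ⋃ i, s i := by
    ext x
    simp only [Set.mem_ofPred_eq, dyadicMaxW, lt_iSup_iff, Set.mem_iUnion, s]
    constructor
    · rintro ⟨Q, hQ, hx, h⟩
      obtain ⟨i, rfl⟩ := he Q hQ
      refine ⟨i, ?_⟩
      rw [if_pos h]; exact hx
    · rintro ⟨i, hi⟩
      split_ifs at hi with h
      · exact ⟨e i, heD i, hi, h⟩
      · exact absurd hi (Set.notMem_empty x)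
  have hm : ∀ i, MeasurableSet (s i) := by
    intro i
    simp only [s]
    split_ifs
    · exact (e i).measurableSet
    · exact MeasurableSet.empty
  rw [hE]
  refine ⟨MeasurableSet.iUnion hm, seq_laminar _ s hm ?_ _ l ?_⟩
  · intro i j
    simp only [s]
    split_ifs
    · exact hD.2.1 _ (heD i) _ (heD j)
    all_goals simp
  · intro i
    simp only [s]
    split_ifs with h
    · set Q := e i
      have hμ : wMeasure w Q.toSet = wInt w Q.toSet := by
        rw [wMeasure, withDensity_apply _ Q.measurableSet, wInt]
      have hμt : wMeasure w Q.toSet ≠ ⊤ := by rw [hμ]; exact (Q.wInt_lt_top hw).ne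
      have h1 : 2 * l * wMeasure w Q.toSet ≤ ∫⁻ x in Q.toSet, g x ∂(wMeasure w) := by
        rw [wMeasure_lintegral hw _ Q.measurableSet, hμ]
        apply ENNReal.mul_le_of_le_div
        rw [ENNReal.div_eq_inv_mul]
        exact h.le
      have h2 : ∫⁻ x in Q.toSet, g x ∂(wMeasure w) ≤
          ∫⁻ x in Q.toSet, {x | l < g x}.indicator g x ∂(wMeasure w)
            + l * wMeasure w Q.toSet := by
        rw [← setLIntegral_const, ← lintegral_add_right _ measurable_const]
        refine lintegral_mono fun x => ?_
        by_cases hx : l < g x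
        · simp [Set.indicator, hx]
        · simp [Set.indicator, hx, not_lt.1 hx]
      have h3 : l * wMeasure w Q.toSet + l * wMeasure w Q.toSet ≤
          ∫⁻ x in Q.toSet, {x | l < g x}.indicator g x ∂(wMeasure w)
            + l * wMeasure w Q.toSet := by
        rw [← two_mul, ← mul_assoc]
        exact h1.trans h2
      exact (ENNReal.add_le_add_iff_right (ENNReal.mul_ne_top hl hμt)).1 h3
    · simp

/-- Power growth of `φ`. -/
theorem phi_growth {φ : ℝ → ℝ} {α : ℝ} (hΦ : PhiClass φ) (hα0 : 0 < α)
    (hqc : QuasiConvexPhi fun t => φ t ^ α) :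
    φ 0 = 0 ∧ ∃ a : ℝ, 1 ≤ a ∧ ∀ θ s : ℝ, 0 ≤ θ → θ ≤ 1 → 0 ≤ s →
      φ (θ * s) ≤ (a * θ) ^ (1 / α) * φ (a * s) := by
  obtain ⟨hmono, hnn, h0, -⟩ := hΦ
  have hφ0 : φ 0 = 0 := by
    refine le_antisymm ?_ (hnn 0 le_rfl)
    refine ge_of_tendsto h0 ?_
    filter_upwards [self_mem_nhdsWithin] with t ht
    exact hmono le_rfl (le_of_lt ht)
  refine ⟨hφ0, ?_⟩
  obtain ⟨ψ, a, ha, hc, hψ⟩ := hqc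
  refine ⟨a, ha, fun θ s hθ0 hθ1 hs => ?_⟩
  have ha0 : 0 < a := by linarith
  have hψ0 : ψ 0 ≤ 0 := by
    have := (hψ 0 le_rfl).1
    simpa [hφ0, Real.zero_rpow hα0.ne'] using this
  have h1 : ψ (a * (θ * s)) ≤ θ * ψ (a * s) := by
    have := hc.2 (Set.mem_Ici.2 (le_refl (0 : ℝ)))
      (Set.mem_Ici.2 (by positivity : 0 ≤ a * s))
      (by linarith : 0 ≤ 1 - θ) hθ0 (by ring)
    simp only [smul_eq_mul, mul_zero, zero_add] at this
    have e : θ * (a * s) = a * (θ * s) := by ring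
    rw [e] at this
    nlinarith
  have h2 : φ (θ * s) ^ α ≤ (a * θ) * φ (a * s) ^ α := by
    have h3 := (hψ (θ * s) (by positivity)).2
    have h4 := (hψ (a * s) (by positivity)).1
    calc φ (θ * s) ^ α ≤ a * ψ (a * (θ * s)) := h3
      _ ≤ a * (θ * ψ (a * s)) := by gcongr
      _ ≤ a * (θ * φ (a * s) ^ α) := by gcongr
      _ = _ := by ring
  have hA := hnn (θ * s) (by positivity)
  have hB := hnn (a * s) (by positivity)
  have h5 := Real.rpow_le_rpow (by positivity) h2 (by positivity : 0 ≤ 1 / α)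
  rw [Real.mul_rpow (by positivity) (by positivity), ← Real.rpow_mul hA, ← Real.rpow_mul hB,
    mul_one_div_cancel hα0.ne', Real.rpow_one, Real.rpow_one] at h5
  exact h5

theorem pointwise_sum {φ : ℝ → ℝ} (hΦ : PhiClass φ) {p a : ℝ} (hp : 1 < p) (ha : 1 ≤ a)
    (hg : ∀ θ s : ℝ, 0 ≤ θ → θ ≤ 1 → 0 ≤ s → φ (θ * s) ≤ (a * θ) ^ p * φ (a * s))
    (v : ℝ) (hv : 0 ≤ v) :
    ∑' k : ℤ, ENNReal.ofReal (φ (2 ^ (k + 1))) * ((ENNReal.ofReal (2 ^ (k - 1)))⁻¹ *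
      (if (2 : ℝ) ^ (k - 1) < v then ENNReal.ofReal v else 0)) ≤
    ENNReal.ofReal (2 * a ^ p * (1 - 2 * (1 / 2 : ℝ) ^ p)⁻¹) * ENNReal.ofReal (φ (a * (4 * v))) := by
  have ha0 : 0 < a := by linarith
  rcases hv.eq_or_lt with rfl | hv
  · simp
  obtain ⟨m, hm1, hm2⟩ := exists_mem_Ioc_zpow hv (one_lt_two : (1 : ℝ) < 2)
  set F : ℤ → ℝ≥0∞ := fun k => ENNReal.ofReal (φ (2 ^ (k + 1))) *
    ((ENNReal.ofReal (2 ^ (k - 1)))⁻¹ *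
      (if (2 : ℝ) ^ (k - 1) < v then ENNReal.ofReal v else 0)) with hF
  have hinj : Function.Injective fun j : ℕ => m + 1 - (j : ℤ) := by
    intro i j h
    simp only at h
    omega
  have hsupp : Function.support F ⊆ Set.range fun j : ℕ => m + 1 - (j : ℤ) := by
    intro k hk
    have hlt : (2 : ℝ) ^ (k - 1) < v := by
      by_contra hcon
      apply hk
      simp [hF, hcon]
    have h2 : k - 1 < m + 1 := (zpow_lt_zpow_iff_right₀ (one_lt_two : (1 : ℝ) < 2)).1 (hlt.trans_le hm2)
    refine ⟨(m + 1 - k).toNat, ?_⟩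
    simp only
    omega
  rw [← hinj.tsum_eq hsupp]
  set r : ℝ := 2 * (1 / 2 : ℝ) ^ p with hr
  have hr0 : 0 ≤ r := by positivity
  have hr1 : r < 1 := by
    have : (1 / 2 : ℝ) ^ p < (1 / 2 : ℝ) ^ (1 : ℝ) :=
      Real.rpow_lt_rpow_of_exponent_gt (by norm_num) (by norm_num) hp
    rw [Real.rpow_one] at this
    rw [hr]; linarith
  have hφ : 0 ≤ φ (a * (4 * v)) := hΦ.2.1 _ (by positivity)
  have hterm : ∀ j : ℕ, F (m + 1 - (j : ℤ)) ≤
      ENNReal.ofReal (2 * a ^ p * φ (a * (4 * v))) * ENNReal.ofReal r ^ j := by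
    intro j
    have hpos : (0 : ℝ) < 2 ^ (m + 1 - (j : ℤ) - 1) := by positivity
    have hA : F (m + 1 - (j : ℤ)) ≤ ENNReal.ofReal (φ (2 ^ (m + 1 - (j : ℤ) + 1)) *
        ((2 ^ (m + 1 - (j : ℤ) - 1))⁻¹ * v)) := by
      rw [ENNReal.ofReal_mul (hΦ.2.1 _ (by positivity)), ENNReal.ofReal_mul (by positivity),
        ENNReal.ofReal_inv_of_pos hpos]
      simp only [hF]
      gcongr
      split_ifs
      · exact le_rfl
      · exact zero_le
    refine hA.trans ?_
    rw [← ENNReal.ofReal_pow hr0, ← ENNReal.ofReal_mul (by positivity)]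
    apply ENNReal.ofReal_le_ofReal
    have e1 : (2 : ℝ) ^ (m + 1 - (j : ℤ) + 1) = (1 / 2) ^ j * 2 ^ (m + 2) := by
      rw [show m + 1 - (j : ℤ) + 1 = (m + 2) - (j : ℤ) by ring, zpow_sub₀ (by norm_num), zpow_natCast,
        one_div, inv_pow]
      field_simp
    have e2 : ((2 : ℝ) ^ (m + 1 - (j : ℤ) - 1))⁻¹ = 2 ^ j * (2 ^ m)⁻¹ := by
      rw [show m + 1 - (j : ℤ) - 1 = m - (j : ℤ) by ring, zpow_sub₀ (by norm_num), zpow_natCast]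
      field_simp
    have e3 : (2 : ℝ) ^ (m + 1) = 2 ^ m * 2 := zpow_add_one₀ (by norm_num) m
    have e4 : (2 : ℝ) ^ (m + 2) = 2 ^ m * 4 := by
      rw [zpow_add₀ (by norm_num)]; norm_num
    have hm0 : (0 : ℝ) < 2 ^ m := by positivity
    have g1 : φ (2 ^ (m + 1 - (j : ℤ) + 1)) ≤ (a * (1 / 2) ^ j) ^ p * φ (a * (4 * v)) := by
      rw [e1]
      refine (hg _ _ (by positivity) (pow_le_one₀ (by norm_num) (by norm_num)) (by positivity)).trans ?_
      gcongr
      apply hΦ.1 (by positivity)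
      gcongr
      rw [e4]; linarith
    have g2 : ((2 : ℝ) ^ (m + 1 - (j : ℤ) - 1))⁻¹ * v ≤ 2 ^ j * 2 := by
      rw [e2, mul_assoc]
      gcongr
      rw [inv_mul_le_iff₀ hm0, ← e3]
      exact hm2
    calc _ ≤ ((a * (1 / 2) ^ j) ^ p * φ (a * (4 * v))) * (2 ^ j * 2) := by gcongr
      _ = 2 * a ^ p * φ (a * (4 * v)) * r ^ j := by
        rw [Real.mul_rpow ha0.le (by positivity), hr, mul_pow, ← Real.rpow_natCast ((1 / 2 : ℝ) ^ p),
          ← Real.rpow_natCast (1 / 2 : ℝ), ← Real.rpow_mul (by norm_num), ← Real.rpow_mul (by norm_num),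
          mul_comm p]
        ring
  refine (ENNReal.tsum_le_tsum hterm).trans ?_
  rw [ENNReal.tsum_mul_left, ENNReal.tsum_geometric, ← ENNReal.ofReal_one,
    ← ENNReal.ofReal_sub _ hr0, ← ENNReal.ofReal_inv_of_pos (by linarith),
    ← ENNReal.ofReal_mul (by positivity), ← ENNReal.ofReal_mul (by
      have : 0 < 1 - r := by linarith
      positivity)]
  apply le_of_eq
  congr 1
  ring

theorem pointwise_phi {φ : ℝ → ℝ} (hΦ : PhiClass φ) (h0 : φ 0 = 0) (t : ℝ≥0∞) :
    ENNReal.ofReal (φ t.toReal) ≤ ∑' k : ℤ, ENNReal.ofReal (φ (2 ^ (k + 1))) *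
      (if 2 * ENNReal.ofReal (2 ^ (k - 1)) < t then 1 else 0) := by
  rcases (ENNReal.toReal_nonneg (a := t)).eq_or_lt with h | h
  · simp [← h, h0]
  obtain ⟨k, hk1, hk2⟩ := exists_mem_Ioc_zpow h (one_lt_two : (1 : ℝ) < 2)
  refine le_trans ?_ (ENNReal.le_tsum k)
  have e : 2 * ENNReal.ofReal (2 ^ (k - 1)) = ENNReal.ofReal (2 ^ k) := by
    rw [show (2 : ℝ≥0∞) = ENNReal.ofReal 2 by simp, ← ENNReal.ofReal_mul (by norm_num),
      zpow_sub_one₀ (by norm_num)]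
    congr 1
    ring
  rw [if_pos, mul_one]
  · exact ENNReal.ofReal_le_ofReal (hΦ.1 h.le hk2)
  · rw [e]
    exact (ENNReal.ofReal_lt_iff_lt_toReal (by positivity) (ENNReal.toReal_pos_iff.1 h).2.ne).2 hk1

end SparseCZ

open SparseCZ in
/-- weighted modular inequality for the weighted dyadic maximal operator,
with constant depending only on `φ` and `α` (independent of `w`). -/
theorem stmt12 (φ : ℝ → ℝ) (α : ℝ) (hΦ : PhiClass φ) (hα0 : 0 < α) (hα1 : α < 1)
    (hqc : QuasiConvexPhi fun t => φ t ^ α) :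
    ∃ a₂ : ℝ, 1 < a₂ ∧
      ∀ (n : ℕ) (w : Rn n → ℝ), IsWeight w → AinftyConst n w ≠ ⊤ →
      ∀ D : Set (Cube n), IsDyadicGrid D →
      ∀ f : Rn n → ℝ, Measurable f →
        modularE φ w (dyadicMaxW D w fun y => ENNReal.ofReal |f y|) ≤
          ENNReal.ofReal a₂ * modularE φ w (fun x => ENNReal.ofReal (a₂ * |f x|)) := by
  obtain ⟨hφ0, a, ha, hg⟩ := phi_growth hΦ hα0 hqc
  have hp : 1 < 1 / α := by rw [lt_div_iff₀ hα0]; linarith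
  set C : ℝ := 2 * a ^ (1 / α) * (1 - 2 * (1 / 2 : ℝ) ^ (1 / α))⁻¹ with hC
  have ha2 : (1 : ℝ) < max C (a * 4) := lt_max_of_lt_right (by linarith)
  refine ⟨max C (a * 4), ha2, ?_⟩
  intro n w hw _ D hD f hf
  set g : Rn n → ℝ≥0∞ := fun y => ENNReal.ofReal |f y| with hgdef
  have hgm : Measurable g := hf.abs.ennreal_ofReal
  have hmod : ∀ u : Rn n → ℝ≥0∞,
      modularE φ w u = ∫⁻ x, ENNReal.ofReal (φ (u x).toReal) ∂(wMeasure w) := by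
    intro u
    have := wMeasure_lintegral hw Set.univ MeasurableSet.univ
      (fun x => ENNReal.ofReal (φ (u x).toReal))
    simpa [modularE] using this.symm
  rw [hmod, hmod]
  have hwt := fun k : ℤ => weak_type hw hD g (ENNReal.ofReal (2 ^ (k - 1))) ENNReal.ofReal_ne_top
  have hlm : ∀ k : ℤ, MeasurableSet {x | ENNReal.ofReal (2 ^ (k - 1)) < g x} := fun k =>
    measurableSet_lt measurable_const hgm
  calc ∫⁻ x, ENNReal.ofReal (φ (dyadicMaxW D w g x).toReal) ∂(wMeasure w)
      ≤ ∫⁻ x, ∑' k : ℤ, ENNReal.ofReal (φ (2 ^ (k + 1))) *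
        {x | 2 * ENNReal.ofReal (2 ^ (k - 1)) < dyadicMaxW D w g x}.indicator 1 x
          ∂(wMeasure w) := by
        refine lintegral_mono fun x => (pointwise_phi hΦ hφ0 _).trans (le_of_eq ?_)
        simp [Set.indicator]
    _ = ∑' k : ℤ, ENNReal.ofReal (φ (2 ^ (k + 1))) *
        wMeasure w {x | 2 * ENNReal.ofReal (2 ^ (k - 1)) < dyadicMaxW D w g x} := by
        rw [lintegral_tsum fun k =>
          ((measurable_one.indicator (hwt k).1).const_mul _).aemeasurable]
        refine tsum_congr fun k => ?_
        rw [lintegral_const_mul _ (measurable_one.indicator (hwt k).1),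
          lintegral_indicator_one (hwt k).1]
    _ ≤ ∑' k : ℤ, ENNReal.ofReal (φ (2 ^ (k + 1))) * ((ENNReal.ofReal (2 ^ (k - 1)))⁻¹ *
        ∫⁻ x, {x | ENNReal.ofReal (2 ^ (k - 1)) < g x}.indicator g x ∂(wMeasure w)) := by
        refine ENNReal.tsum_le_tsum fun k => ?_
        gcongr
        have h2 : ENNReal.ofReal ((2 : ℝ) ^ (k - 1)) ≠ 0 := by
          have : (0 : ℝ) < 2 ^ (k - 1) := by positivity
          simpa using this
        rw [← ENNReal.div_eq_inv_mul,
          ENNReal.le_div_iff_mul_le (Or.inl h2) (Or.inl ENNReal.ofReal_ne_top), mul_comm]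
        exact (hwt k).2
    _ = ∫⁻ x, ∑' k : ℤ, ENNReal.ofReal (φ (2 ^ (k + 1))) * ((ENNReal.ofReal (2 ^ (k - 1)))⁻¹ *
        {x | ENNReal.ofReal (2 ^ (k - 1)) < g x}.indicator g x) ∂(wMeasure w) := by
        rw [lintegral_tsum fun k =>
          (((hgm.indicator (hlm k)).const_mul _).const_mul _).aemeasurable]
        refine tsum_congr fun k => ?_
        rw [lintegral_const_mul _ ((hgm.indicator (hlm k)).const_mul _),
          lintegral_const_mul _ (hgm.indicator (hlm k))]
    _ ≤ ∫⁻ x, ENNReal.ofReal (max C (a * 4)) *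
        ENNReal.ofReal (φ (ENNReal.ofReal (max C (a * 4) * |f x|)).toReal) ∂(wMeasure w) := by
        refine lintegral_mono fun x => ?_
        have h1 := pointwise_sum hΦ hp ha hg |f x| (abs_nonneg _)
        refine le_trans (le_of_eq ?_) (h1.trans ?_)
        · refine tsum_congr fun k => ?_
          have hz : (0 : ℝ) ≤ 2 ^ (k - 1) := by positivity
          simp only [Set.indicator, Set.mem_ofPred_eq, hgdef,
            ENNReal.ofReal_lt_ofReal_iff_of_nonneg hz]
        · have hpos : 0 ≤ max C (a * 4) := by linarith
          rw [ENNReal.toReal_ofReal (by positivity)]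
          refine mul_le_mul' (ENNReal.ofReal_le_ofReal (le_max_left _ _))
            (ENNReal.ofReal_le_ofReal (hΦ.1 (by positivity) ?_))
          rw [← mul_assoc]
          gcongr
          exact le_max_right _ _
    _ = _ := lintegral_const_mul' _ _ ENNReal.ofReal_ne_top
end
end
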